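/- arXiv:2005.00064 — 3 statements merged into one kernel-verified Lean document; each statement's English description precedes it below -/
import Mathlib

section
/- Fix integers r ≥ 1 and d ≥ 2. For each n, let G_n be an (r+1)-uniform linear hypergraph on n vertices with maximum degree at most d, and let I(G_n) be the random independent set produced by the randomized greedy algorithm on G_n. Then for any function b : ℕ → (0,∞) with b(n) → ∞ as n → ∞, we have P[ | |I(G_n)| − E[|I(G_n)|] | > √n·b(n) ] → 0 as n → ∞. -/
open MeasureTheory Finset

/-- A vertex `v` is selected by the greedy algorithm (largest weight first) run on the
hypergraph with edge set `E` and weights `w`: `v` is selected iff there is no edge `e`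
containing `v` all of whose other vertices have larger weight and are themselves selected. -/
def greedySelect {V : Type*} [Fintype V] [DecidableEq V]
    (E : Finset (Finset V)) (w : V → ℝ) (v : V) : Prop :=
  ¬ ∃ e ∈ E, v ∈ e ∧ (∀ u ∈ e, u ≠ v → w v < w u) ∧
      (∀ u ∈ e, u ≠ v → w v < w u → greedySelect E w u)
termination_by (Finset.univ.filter (fun u => w v < w u)).card
decreasing_by
  rename_i hvu
  apply Finset.card_lt_card
  constructor
  · intro x hx
    simp only [Finset.mem_filter, Finset.mem_univ, true_and] at *
    linarith
  · intro hsub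
    have hmem : u ∈ Finset.univ.filter (fun x => w v < w x) := by
      simp only [Finset.mem_filter, Finset.mem_univ, true_and]; exact hvu
    have := hsub hmem
    simp only [Finset.mem_filter, Finset.mem_univ, true_and] at this
    exact lt_irrefl _ this

open scoped Classical in
/-- The independent set produced by the greedy algorithm. -/
noncomputable def greedySet {V : Type*} [Fintype V] [DecidableEq V]
    (E : Finset (Finset V)) (w : V → ℝ) : Finset V :=
  Finset.univ.filter (fun v => greedySelect E w v)

/-- The product measure giving each vertex an independent Uniform[0,1] weight. -/
noncomputable def uniformWeights (V : Type*) [Fintype V] : Measure (V → ℝ) :=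
  Measure.pi fun _ : V => volume.restrict (Set.Icc (0 : ℝ) 1)

open ProbabilityTheory

lemma covariance_le_of_abs_le_one {Ω : Type*} [MeasurableSpace Ω] {μ : Measure Ω}
    [IsProbabilityMeasure μ] {X Y : Ω → ℝ} (hX : Measurable X) (hY : Measurable Y)
    (hX1 : ∀ ω, |X ω| ≤ 1) (hY1 : ∀ ω, |Y ω| ≤ 1) {p : ℝ} (hp : μ.real {ω | X ω ≠ 0} ≤ p) :
    cov[X, Y; μ] ≤ 2 * p := by
  have hset : MeasurableSet {ω | X ω ≠ 0} := (hX (measurableSet_singleton 0)).compl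
  have habs : ∀ Z : Ω → ℝ, (∀ ω, |Z ω| ≤ |X ω|) → |∫ ω, Z ω ∂μ| ≤ p := by
    intro Z hZ
    refine le_trans ?_ hp
    rw [← integral_indicator_one hset, ← Real.norm_eq_abs]
    refine norm_integral_le_of_norm_le ((integrable_const 1).indicator hset) (ae_of_all _ ?_)
    intro ω
    by_cases h : X ω = 0
    · have := hZ ω
      simp_all
    · simpa [h] using (hZ ω).trans (hX1 ω)
  have hYint : |∫ ω, Y ω ∂μ| ≤ 1 := by
    simpa using norm_integral_le_of_norm_le_const (μ := μ) (ae_of_all μ fun ω => (Real.norm_eq_abs _).trans_le (hY1 ω))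
  have h1 := habs (X * Y) fun ω => by
    simpa [abs_mul] using mul_le_of_le_one_right (abs_nonneg (X ω)) (hY1 ω)
  have h2 := habs X fun ω => le_rfl
  rw [covariance_eq_sub (MemLp.of_bound hX.aestronglyMeasurable 1 (ae_of_all _ hX1))
    (MemLp.of_bound hY.aestronglyMeasurable 1 (ae_of_all _ hY1))]
  have h3 : |(∫ ω, X ω ∂μ) * ∫ ω, Y ω ∂μ| ≤ p := by
    rw [abs_mul]
    exact (mul_le_of_le_one_right (abs_nonneg _) hYint).trans h2
  linarith [(abs_le.1 h1).2, (abs_le.1 h3).1]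

lemma variance_sum_range_le {Ω : Type*} [MeasurableSpace Ω] {μ : Measure Ω}
    [IsProbabilityMeasure μ] {X : ℕ → Ω → ℝ} (hX : ∀ k, MemLp (X k) 2 μ) (N : ℕ) :
    Var[∑ k ∈ Finset.range N, X k; μ] ≤ 2 * ∑ k ∈ Finset.range N, 2 ^ k * Var[X k; μ] := by
  have hsum := memLp_finsetSum' (Finset.range N) fun k _ => hX k
  have hsq : ∀ k, Integrable (fun ω => (X k ω - μ[X k]) ^ 2) μ := fun k =>
    ((hX k).sub (memLp_const _)).integrable_sq
  have hgeom : ∑ k ∈ Finset.range N, (1 / 2 : ℝ) ^ k ≤ 2 := by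
    simpa using sum_geometric_two_le N
  simp_rw [fun k => variance_eq_integral (hX k).aemeasurable]
  rw [variance_eq_integral hsum.aemeasurable]
  simp_rw [← integral_const_mul]
  rw [← integral_finsetSum _ fun k _ => (hsq k).const_mul _, ← integral_const_mul]
  refine integral_mono (hsum.sub (memLp_const _)).integrable_sq
    ((integrable_finsetSum _ fun k _ => (hsq k).const_mul _).const_mul _) fun ω => ?_
  have hcent : (∑ k ∈ Finset.range N, X k) ω - μ[∑ k ∈ Finset.range N, X k] =
      ∑ k ∈ Finset.range N, (X k ω - μ[X k]) := by
    simp only [Finset.sum_apply]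
    rw [integral_finsetSum _ fun k _ => (hX k).integrable (by norm_num), Finset.sum_sub_distrib]
  simp only [hcent]
  refine (Finset.sum_sq_le_sum_mul_sum_of_sq_le_mul _ (f := fun k => (1 / 2 : ℝ) ^ k)
    (g := fun k => 2 ^ k * (X k ω - μ[X k]) ^ 2) (fun _ _ => by positivity)
    (fun _ _ => by positivity) fun k _ => ?_).trans
    (mul_le_mul_of_nonneg_right hgeom (Finset.sum_nonneg fun _ _ => by positivity))
  rw [← mul_assoc, ← mul_pow]
  norm_num

instance : IsProbabilityMeasure (volume.restrict (Set.Icc (0 : ℝ) 1)) :=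
  ⟨by simp⟩

instance (V : Type*) [Fintype V] : IsProbabilityMeasure (uniformWeights V) := by
  unfold uniformWeights
  infer_instance

lemma measurePreserving_uniformWeights_comp {V : Type*} [Fintype V] (σ : Equiv.Perm V) :
    MeasurePreserving (fun w : V → ℝ => w ∘ σ) (uniformWeights V) (uniformWeights V) := by
  have h := measurePreserving_piCongrLeft
    (fun _ : V => volume.restrict (Set.Icc (0 : ℝ) 1)) σ.symm
  convert! h using 1
  ext w v
  simpa using! (Equiv.piCongrLeft_apply_apply (P := fun _ => ℝ) (e := σ.symm) w (σ v)).symm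

section GreedyLocality

variable {V : Type*}

/-- The greedy selection rule with recursion truncated at depth `k`. -/
def truncSelect (E : Finset (Finset V)) (w : V → ℝ) : ℕ → V → Prop
  | 0, _ => True
  | k + 1, v => ¬ ∃ e ∈ E, v ∈ e ∧ (∀ u ∈ e, u ≠ v → w v < w u) ∧
      (∀ u ∈ e, u ≠ v → truncSelect E w k u)

open scoped Classical in
/-- The change in the indicator of selection when the truncation depth grows from `k` to `k + 1`. -/
noncomputable def truncIncrement (E : Finset (Finset V)) (k : ℕ) (v : V) (w : V → ℝ) : ℝ :=
  (if truncSelect E w (k + 1) v then 1 else 0) - (if truncSelect E w k v then 1 else 0)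

lemma abs_truncIncrement_le (E : Finset (Finset V)) (k : ℕ) (v : V) (w : V → ℝ) :
    |truncIncrement E k v w| ≤ 1 := by
  unfold truncIncrement
  split_ifs <;> simp

lemma measurableSet_truncSelect [Fintype V] (E : Finset (Finset V)) (k : ℕ) (v : V) :
    MeasurableSet {w : V → ℝ | truncSelect E w k v} := by
  induction k generalizing v with
  | zero => simp [truncSelect]
  | succ k ih =>
    simp only [truncSelect]
    refine measurableSet_setOfPred.2 <| Measurable.not <| Measurable.exists fun e =>
      measurable_const.and <| measurable_const.and <| Measurable.and ?_ ?_
    · exact Measurable.forall fun u => measurable_const.imp <| measurable_const.imp <|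
        measurableSet_setOfPred.1 <|
        measurableSet_lt (measurable_pi_apply v) (measurable_pi_apply u)
    · exact Measurable.forall fun u => measurable_const.imp <| measurable_const.imp <|
        measurableSet_setOfPred.1 (ih u)

lemma measurable_truncIncrement [Fintype V] (E : Finset (Finset V)) (k : ℕ) (v : V) :
    Measurable (truncIncrement E k v) := by
  classical
  exact (Measurable.ite (measurableSet_truncSelect E (k + 1) v) measurable_const
    measurable_const).sub (Measurable.ite (measurableSet_truncSelect E k v) measurable_const
    measurable_const)

lemma memLp_truncIncrement [Fintype V] (E : Finset (Finset V)) (k : ℕ) (v : V) :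
    MemLp (truncIncrement E k v) 2 (uniformWeights V) :=
  MemLp.of_bound (measurable_truncIncrement E k v).aestronglyMeasurable 1
    (ae_of_all _ (abs_truncIncrement_le E k v))

variable [DecidableEq V]

/-- The closed neighbourhood of a vertex in a hypergraph. -/
def closedNbhd (E : Finset (Finset V)) (v : V) : Finset V :=
  insert v ((E.filter (fun e => v ∈ e)).biUnion id)

/-- The closed ball of radius `k` around a vertex in a hypergraph. -/
def hyperBall (E : Finset (Finset V)) : ℕ → V → Finset V
  | 0, v => {v}
  | k + 1, v => (closedNbhd E v).biUnion (hyperBall E k)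

/-- The walks with `k` steps starting at a vertex, as lists of `k + 1` vertices. -/
def hyperWalks (E : Finset (Finset V)) : ℕ → V → Finset (List V)
  | 0, v => {[v]}
  | k + 1, v => (closedNbhd E v).biUnion fun u => (hyperWalks E k u).image (List.cons v)

lemma mem_closedNbhd {E : Finset (Finset V)} {u v : V} :
    u ∈ closedNbhd E v ↔ u = v ∨ ∃ e ∈ E, v ∈ e ∧ u ∈ e := by
  simp [closedNbhd, and_assoc]

lemma mem_closedNbhd_comm {E : Finset (Finset V)} {u v : V} :
    u ∈ closedNbhd E v ↔ v ∈ closedNbhd E u := by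
  simp only [mem_closedNbhd]
  grind

lemma card_closedNbhd_le {E : Finset (Finset V)} {r d : ℕ}
    (huniform : ∀ e ∈ E, e.card = r + 1)
    (hdeg : ∀ v : V, (E.filter (fun e => v ∈ e)).card ≤ d) (v : V) :
    (closedNbhd E v).card ≤ d * (r + 1) + 1 := by
  refine (Finset.card_insert_le _ _).trans (Nat.succ_le_succ ?_)
  refine (Finset.card_biUnion_le_card_mul _ _ (r + 1) fun e he => ?_).trans
    (Nat.mul_le_mul_right _ (hdeg v))
  exact (huniform e (Finset.mem_filter.1 he).1).le

lemma self_mem_hyperBall (E : Finset (Finset V)) (k : ℕ) (v : V) : v ∈ hyperBall E k v := by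
  induction k with
  | zero => simp [hyperBall]
  | succ k ih => exact Finset.mem_biUnion.2 ⟨v, mem_closedNbhd.2 (.inl rfl), ih⟩

lemma hyperBall_subset_succ (E : Finset (Finset V)) (k : ℕ) (v : V) :
    hyperBall E k v ⊆ hyperBall E (k + 1) v := fun _ hx =>
  Finset.mem_biUnion.2 ⟨v, mem_closedNbhd.2 (.inl rfl), hx⟩

lemma card_hyperBall_le {E : Finset (Finset V)} {D : ℕ}
    (hD : ∀ v, (closedNbhd E v).card ≤ D) (k : ℕ) (v : V) :
    (hyperBall E k v).card ≤ D ^ k := by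
  induction k generalizing v with
  | zero => simp [hyperBall]
  | succ k ih =>
    rw [pow_succ']
    exact (Finset.card_biUnion_le_card_mul _ _ _ fun u _ => ih u).trans
      (Nat.mul_le_mul_right _ (hD v))

lemma card_hyperWalks_le {E : Finset (Finset V)} {D : ℕ}
    (hD : ∀ v, (closedNbhd E v).card ≤ D) (k : ℕ) (v : V) :
    (hyperWalks E k v).card ≤ D ^ k := by
  induction k generalizing v with
  | zero => simp [hyperWalks]
  | succ k ih =>
    rw [pow_succ']
    exact (Finset.card_biUnion_le_card_mul _ _ _ fun u _ =>
      Finset.card_image_le.trans (ih u)).trans (Nat.mul_le_mul_right _ (hD v))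

lemma length_of_mem_hyperWalks {E : Finset (Finset V)} {k : ℕ} {v : V} {l : List V}
    (hl : l ∈ hyperWalks E k v) : l.length = k + 1 := by
  induction k generalizing v l with
  | zero => simp_all [hyperWalks]
  | succ k ih =>
    simp only [hyperWalks, Finset.mem_biUnion, Finset.mem_image] at hl
    obtain ⟨u, _, l', hl', rfl⟩ := hl
    simp [ih hl']

lemma truncSelect_congr {E : Finset (Finset V)} {w w' : V → ℝ} (k : ℕ) (v : V)
    (h : ∀ u ∈ hyperBall E k v, w u = w' u) : truncSelect E w k v ↔ truncSelect E w' k v := by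
  induction k generalizing v with
  | zero => simp [truncSelect]
  | succ k ih =>
    rw [truncSelect, truncSelect, not_iff_not]
    refine exists_congr fun e => and_congr_right fun he => and_congr_right fun hv => ?_
    have hsub : ∀ u ∈ e, ∀ x ∈ hyperBall E k u, w x = w' x := fun u hu x hx =>
      h x (Finset.mem_biUnion.2 ⟨u, mem_closedNbhd.2 (.inr ⟨e, he, hv, hu⟩), hx⟩)
    have hw : ∀ u ∈ e, w u = w' u := fun u hu => hsub u hu u (self_mem_hyperBall E k u)
    refine and_congr (forall₂_congr fun u hu => ?_) (forall₂_congr fun u hu => ?_)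
    · rw [hw u hu, hw v hv]
    · rw [ih u (hsub u hu)]

lemma exists_increasing_walk_of_truncSelect_ne {E : Finset (Finset V)} {w : V → ℝ} (k : ℕ) (v : V)
    (h : ¬ (truncSelect E w (k + 1) v ↔ truncSelect E w k v)) :
    ∃ l ∈ hyperWalks E k v, l.Pairwise (fun a b => w a < w b) ∧ ∀ x ∈ l, w v ≤ w x := by
  induction k generalizing v with
  | zero => exact ⟨[v], by simp [hyperWalks]⟩
  | succ k ih =>
    have key : ∃ e ∈ E, v ∈ e ∧ ∃ u ∈ e, w v < w u ∧
        ¬ (truncSelect E w (k + 1) u ↔ truncSelect E w k u) := by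
      by_contra! hc
      apply h
      rw [truncSelect, truncSelect, not_iff_not]
      refine exists_congr fun e => and_congr_right fun he => and_congr_right fun hv =>
        and_congr_right fun hlt => forall₂_congr fun u hu => forall_congr' fun hne => ?_
      exact hc e he hv u hu (hlt u hu hne)
    obtain ⟨e, he, hv, u, hu, hvu, hne⟩ := key
    obtain ⟨l, hl, hp, hle⟩ := ih u hne
    refine ⟨v :: l, Finset.mem_biUnion.2 ⟨u, mem_closedNbhd.2 (.inr ⟨e, he, hv, hu⟩),
      Finset.mem_image_of_mem _ hl⟩, List.pairwise_cons.2
      ⟨fun x hx => hvu.trans_le (hle x hx), hp⟩, fun x hx => ?_⟩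
    rcases List.mem_cons.1 hx with rfl | hx
    · exact le_rfl
    · exact hvu.le.trans (hle x hx)

lemma truncIncrement_congr {E : Finset (Finset V)} {k : ℕ} {v : V} {w w' : V → ℝ}
    (h : ∀ u ∈ hyperBall E (k + 1) v, w u = w' u) :
    truncIncrement E k v w = truncIncrement E k v w' := by
  have h₁ := propext (truncSelect_congr (k + 1) v h)
  have h₂ := propext
    (truncSelect_congr k v fun u hu => h u (hyperBall_subset_succ E k v hu))
  unfold truncIncrement
  congr!

variable [Fintype V]

lemma card_filter_mem_hyperBall_le {E : Finset (Finset V)} {D : ℕ}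
    (hD : ∀ v, (closedNbhd E v).card ≤ D) (k : ℕ) (x : V) :
    (univ.filter fun v => x ∈ hyperBall E k v).card ≤ D ^ k := by
  induction k generalizing x with
  | zero =>
    have : (univ.filter fun v => x ∈ hyperBall E 0 v) = {x} := by
      ext v
      simp [hyperBall, eq_comm]
    simp [this]
  | succ k ih =>
    have hsub : (univ.filter fun v => x ∈ hyperBall E (k + 1) v) ⊆
        (univ.filter fun v => x ∈ hyperBall E k v).biUnion (closedNbhd E) := by
      intro v hv
      simp only [hyperBall, Finset.mem_filter, Finset.mem_univ, true_and,
        Finset.mem_biUnion] at hv ⊢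
      obtain ⟨u, hu, hx⟩ := hv
      exact ⟨u, hx, mem_closedNbhd_comm.1 hu⟩
    rw [pow_succ]
    exact (Finset.card_le_card hsub).trans ((Finset.card_biUnion_le_card_mul _ _ _
      fun u _ => hD u).trans (Nat.mul_le_mul_right _ (ih x)))

lemma card_filter_not_disjoint_hyperBall_le {E : Finset (Finset V)} {D : ℕ}
    (hD : ∀ v, (closedNbhd E v).card ≤ D) (k : ℕ) (u : V) :
    (univ.filter fun v => ¬ Disjoint (hyperBall E k u) (hyperBall E k v)).card
      ≤ D ^ k * D ^ k := by
  have hsub : (univ.filter fun v => ¬ Disjoint (hyperBall E k u) (hyperBall E k v)) ⊆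
      (hyperBall E k u).biUnion fun x => univ.filter fun v => x ∈ hyperBall E k v := by
    intro v hv
    simpa [Finset.not_disjoint_iff] using hv
  exact (Finset.card_le_card hsub).trans ((Finset.card_biUnion_le_card_mul _ _ _
    fun x _ => card_filter_mem_hyperBall_le hD k x).trans
      (Nat.mul_le_mul_right _ (card_hyperBall_le hD k u)))

lemma truncSelect_iff_greedySelect (E : Finset (Finset V)) (w : V → ℝ) (k : ℕ) (v : V)
    (hk : (univ.filter fun u => w v < w u).card < k) :
    truncSelect E w k v ↔ greedySelect E w v := by
  induction k generalizing v with
  | zero => omega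
  | succ k ih =>
    have ih' : ∀ u, w v < w u → (truncSelect E w k u ↔ greedySelect E w u) := by
      intro u hu
      refine ih u (lt_of_lt_of_le (Finset.card_lt_card ?_) (Nat.lt_succ_iff.1 hk))
      refine Finset.ssubset_iff_of_subset (fun x hx => ?_) |>.2 ⟨u, by simpa using hu, by simp⟩
      simp only [Finset.mem_filter, Finset.mem_univ, true_and] at hx ⊢
      exact hu.trans hx
    rw [truncSelect, greedySelect, not_iff_not]
    refine exists_congr fun e => and_congr_right fun _ => and_congr_right fun _ =>
      and_congr_right fun hlt => ?_
    exact ⟨fun h u hu hne hvu => (ih' u hvu).1 (h u hu hne),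
      fun h u hu hne => (ih' u (hlt u hu hne)).2 (h u hu hne (hlt u hu hne))⟩

lemma truncSelect_card_iff (E : Finset (Finset V)) (w : V → ℝ) (v : V) :
    truncSelect E w (Fintype.card V) v ↔ greedySelect E w v :=
  truncSelect_iff_greedySelect E w _ v <| Finset.card_lt_card <|
    Finset.ssubset_iff_of_subset (Finset.subset_univ _) |>.2 ⟨v, by simp, by simp⟩

lemma measure_strictMono_comp_le {m : ℕ} (x : Fin m → V) :
    (uniformWeights V).real {w | StrictMono (w ∘ x)} ≤ 1 / (m.factorial : ℝ) := by
  by_cases hx : Function.Injective x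
  swap
  · have : {w : V → ℝ | StrictMono (w ∘ x)} = ∅ := by
      ext w
      simpa using fun h : StrictMono (w ∘ x) => hx (h.injective.of_comp)
    rw [this]
    simp
  have hmeas : ∀ y : Fin m → V, MeasurableSet {w : V → ℝ | StrictMono (w ∘ y)} := by
    intro y
    simp only [StrictMono]
    exact measurableSet_setOfPred.2 <| Measurable.forall fun i => Measurable.forall fun j =>
      measurable_const.imp <| measurableSet_setOfPred.1 <| measurableSet_lt (measurable_pi_apply _) (measurable_pi_apply _)
  have heq : ∀ τ : Equiv.Perm (Fin m), (uniformWeights V).real {w | StrictMono (w ∘ x ∘ τ)} =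
      (uniformWeights V).real {w | StrictMono (w ∘ x)} := by
    intro τ
    obtain ⟨σ, hσ⟩ := Equiv.Perm.exists_extending_pair x (x ∘ τ) hx (hx.comp τ.injective)
    rw [← (measurePreserving_uniformWeights_comp σ).measureReal_preimage
      (hmeas x).nullMeasurableSet]
    congr 1
    ext w
    have : (w ∘ σ) ∘ x = w ∘ x ∘ τ := by
      ext i
      simp [hσ]
    simp [this]
  have hdisj : Pairwise (Function.onFun Disjoint
      fun τ : Equiv.Perm (Fin m) => {w : V → ℝ | StrictMono (w ∘ x ∘ τ)}) := by
    intro τ τ' hne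
    refine Set.disjoint_left.2 fun w hτ hτ' => hne ?_
    have h₁ := (Tuple.unique_monotone (f := w ∘ x) (σ := τ) (τ := τ') hτ.monotone hτ'.monotone)
    ext i
    have h₂ : Function.Injective (w ∘ x) := by
      have := hτ.injective.comp τ.symm.injective
      convert this using 1
      ext i
      simp
    rw [h₂ (congr_fun h₁ i)]
  have hsum : ∑ τ : Equiv.Perm (Fin m), (uniformWeights V).real {w | StrictMono (w ∘ x ∘ τ)}
      ≤ 1 := by
    rw [← measureReal_iUnion_fintype hdisj fun τ => hmeas (x ∘ τ)]
    exact measureReal_le_one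
  rw [le_div_iff₀ (by positivity), mul_comm]
  simpa [heq, Fintype.card_perm] using hsum

lemma measure_pairwise_lt_le (l : List V) :
    (uniformWeights V).real {w | l.Pairwise fun a b => w a < w b} ≤
      1 / (l.length.factorial : ℝ) := by
  convert measure_strictMono_comp_le l.get using 3
  ext w
  simp [List.pairwise_iff_get, StrictMono]

lemma measure_truncIncrement_ne_zero_le {E : Finset (Finset V)} {D : ℕ}
    (hD : ∀ v, (closedNbhd E v).card ≤ D) (k : ℕ) (v : V) :
    (uniformWeights V).real {w | truncIncrement E k v w ≠ 0} ≤ D ^ k / (k.factorial : ℝ) := by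
  have hsub : {w | truncIncrement E k v w ≠ 0} ⊆
      ⋃ l ∈ hyperWalks E k v, {w | l.Pairwise fun a b => w a < w b} := by
    intro w hw
    obtain ⟨l, hl, hp, _⟩ := exists_increasing_walk_of_truncSelect_ne (E := E) (w := w) k v
      fun h => hw <| sub_eq_zero.2 <| by congr! 1
    exact Set.mem_biUnion hl hp
  calc (uniformWeights V).real {w | truncIncrement E k v w ≠ 0}
      ≤ ∑ l ∈ hyperWalks E k v, (uniformWeights V).real {w | l.Pairwise fun a b => w a < w b} :=
        (measureReal_mono hsub (measure_ne_top _ _)).trans (measureReal_biUnion_finset_le _ _)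
    _ ≤ ∑ l ∈ hyperWalks E k v, 1 / (k.factorial : ℝ) := by
        refine Finset.sum_le_sum fun l hl => (measure_pairwise_lt_le l).trans ?_
        rw [length_of_mem_hyperWalks hl]
        gcongr
        omega
    _ ≤ D ^ k / (k.factorial : ℝ) := by
        rw [Finset.sum_const, nsmul_eq_mul, mul_one_div]
        gcongr
        exact_mod_cast card_hyperWalks_le hD k v

lemma indepFun_of_disjoint_support {S T : Finset V} (hST : Disjoint S T) {X Y : (V → ℝ) → ℝ}
    (hX : Measurable X) (hY : Measurable Y)
    (hXS : ∀ w w', (∀ u ∈ S, w u = w' u) → X w = X w')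
    (hYT : ∀ w w', (∀ u ∈ T, w u = w' u) → Y w = Y w') :
    IndepFun X Y (uniformWeights V) := by
  have hind : iIndepFun (fun (v : V) (w : V → ℝ) => w v) (uniformWeights V) :=
    iIndepFun_pi (X := fun _ x => x) fun _ => aemeasurable_id
  have hres := hind.indepFun_finset S T hST fun v => measurable_pi_apply v
  have hext : ∀ R : Finset V, Measurable fun (y : R → ℝ) (v : V) =>
      if h : v ∈ R then y ⟨v, h⟩ else 0 := by
    intro R
    refine measurable_pi_lambda _ fun v => ?_
    by_cases h : v ∈ R
    · simpa [h] using measurable_pi_apply _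
    · simp [h]
  convert! hres.comp (hX.comp (hext S)) (hY.comp (hext T)) using 1
  · ext w
    exact hXS _ _ fun u hu => by simp [hu]
  · ext w
    exact hYT _ _ fun u hu => by simp [hu]

lemma variance_sum_truncIncrement_le {E : Finset (Finset V)} {D : ℕ}
    (hD : ∀ v, (closedNbhd E v).card ≤ D) (k : ℕ) :
    Var[∑ v, truncIncrement E k v; uniformWeights V] ≤
      Fintype.card V * (2 * D ^ 2 * ((D : ℝ) ^ 3) ^ k / (k.factorial : ℝ)) := by
  rw [variance_sum' fun v _ => memLp_truncIncrement E k v]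
  have hcov : ∀ u v, cov[truncIncrement E k u, truncIncrement E k v; uniformWeights V] ≤
      if ¬ Disjoint (hyperBall E (k + 1) u) (hyperBall E (k + 1) v) then
        2 * (D ^ k / (k.factorial : ℝ)) else 0 := by
    intro u v
    by_cases h : ¬ Disjoint (hyperBall E (k + 1) u) (hyperBall E (k + 1) v)
      <;> [rw [if_pos h]; rw [if_neg h]]
    · exact covariance_le_of_abs_le_one (measurable_truncIncrement E k u)
        (measurable_truncIncrement E k v) (abs_truncIncrement_le E k u)
        (abs_truncIncrement_le E k v) (measure_truncIncrement_ne_zero_le hD k u)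
    · refine (IndepFun.covariance_eq_zero ?_ (memLp_truncIncrement E k u)
        (memLp_truncIncrement E k v)).le
      exact indepFun_of_disjoint_support (not_not.1 h) (measurable_truncIncrement E k u)
        (measurable_truncIncrement E k v) (fun _ _ => truncIncrement_congr)
        (fun _ _ => truncIncrement_congr)
  have hrow : ∀ u, ∑ v, cov[truncIncrement E k u, truncIncrement E k v; uniformWeights V] ≤
      2 * D ^ 2 * ((D : ℝ) ^ 3) ^ k / (k.factorial : ℝ) := by
    intro u
    refine (Finset.sum_le_sum fun v _ => hcov u v).trans ?_
    rw [← Finset.sum_filter, Finset.sum_const, nsmul_eq_mul]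
    have hcard : ((univ.filter fun v =>
        ¬ Disjoint (hyperBall E (k + 1) u) (hyperBall E (k + 1) v)).card : ℝ)
        ≤ D ^ (k + 1) * D ^ (k + 1) := by
      exact_mod_cast card_filter_not_disjoint_hyperBall_le hD (k + 1) u
    calc _ ≤ ((D : ℝ) ^ (k + 1) * D ^ (k + 1)) * (2 * (D ^ k / (k.factorial : ℝ))) := by
          gcongr
      _ = _ := by ring
  refine (Finset.sum_le_sum fun u _ => hrow u).trans ?_
  simp

lemma card_greedySet_eq (E : Finset (Finset V)) :
    (fun w : V → ℝ => ((greedySet E w).card : ℝ)) = fun w => Fintype.card V +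
      (∑ k ∈ Finset.range (Fintype.card V), ∑ v, truncIncrement E k v) w := by
  classical
  ext w
  simp only [Finset.sum_apply]
  rw [Finset.sum_comm]
  have h : ∀ v, ∑ k ∈ Finset.range (Fintype.card V), truncIncrement E k v w =
      (if greedySelect E w v then 1 else 0) - 1 := by
    intro v
    unfold truncIncrement
    rw [Finset.sum_range_sub (fun k => if truncSelect E w k v then (1 : ℝ) else 0)]
    simp [truncSelect_card_iff, truncSelect]
  simp [h, greedySet]

lemma memLp_card_greedySet (E : Finset (Finset V)) :
    MemLp (fun w : V → ℝ => ((greedySet E w).card : ℝ)) 2 (uniformWeights V) := by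
  rw [card_greedySet_eq]
  have hsum : MemLp (∑ k ∈ Finset.range (Fintype.card V), ∑ v, truncIncrement E k v) 2
      (uniformWeights V) :=
    memLp_finsetSum' _ fun k _ => memLp_finsetSum' _ fun v _ => memLp_truncIncrement E k v
  exact (memLp_const (Fintype.card V : ℝ)).add hsum

/-- The variance of the size of the greedy independent set is linear in the number of vertices. -/
lemma variance_card_greedySet_le {E : Finset (Finset V)} {D : ℕ}
    (hD : ∀ v, (closedNbhd E v).card ≤ D) :
    Var[fun w : V → ℝ => ((greedySet E w).card : ℝ); uniformWeights V] ≤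
      Fintype.card V * (4 * D ^ 2 * Real.exp (2 * (D : ℝ) ^ 3)) := by
  have hS : ∀ k, MemLp (∑ v, truncIncrement E k v) 2 (uniformWeights V) := fun k =>
    memLp_finsetSum' _ fun v _ => memLp_truncIncrement E k v
  rw [card_greedySet_eq]
  rw [variance_const_add (memLp_finsetSum' _ fun k _ => hS k).aestronglyMeasurable]
  calc _ ≤ 2 * ∑ k ∈ Finset.range (Fintype.card V),
          2 ^ k * Var[∑ v, truncIncrement E k v; uniformWeights V] := variance_sum_range_le hS _
    _ ≤ 2 * ∑ k ∈ Finset.range (Fintype.card V), 2 ^ k *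
          (Fintype.card V * (2 * D ^ 2 * ((D : ℝ) ^ 3) ^ k / (k.factorial : ℝ))) := by
        gcongr with k
        exact variance_sum_truncIncrement_le hD k
    _ = Fintype.card V * (4 * D ^ 2 * ∑ k ∈ Finset.range (Fintype.card V),
          (2 * (D : ℝ) ^ 3) ^ k / (k.factorial : ℝ)) := by
        simp only [Finset.mul_sum]
        refine Finset.sum_congr rfl fun k _ => ?_
        rw [mul_pow]
        ring
    _ ≤ _ := by
        gcongr
        exact Real.sum_le_exp_of_nonneg (by positivity) _

end GreedyLocality

theorem greedy_concentration
    (r d : ℕ) (hr : 1 ≤ r) (hd : 2 ≤ d)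
    (E : ∀ n : ℕ, Finset (Finset (Fin n)))
    (huniform : ∀ n, ∀ e ∈ E n, e.card = r + 1)
    (hlinear : ∀ n, ∀ e ∈ E n, ∀ f ∈ E n, e ≠ f → (e ∩ f).card ≤ 1)
    (hdeg : ∀ n, ∀ v : Fin n, ((E n).filter (fun e => v ∈ e)).card ≤ d)
    (b : ℕ → ℝ) (hbpos : ∀ n, 0 < b n)
    (hb : Filter.Tendsto b Filter.atTop Filter.atTop) :
    Filter.Tendsto
      (fun n : ℕ => uniformWeights (Fin n)
        {w : Fin n → ℝ | Real.sqrt n * b n <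
          |((greedySet (E n) w).card : ℝ) -
            ∫ w' : Fin n → ℝ, ((greedySet (E n) w').card : ℝ) ∂(uniformWeights (Fin n))|})
      Filter.atTop (nhds 0) := by
  set D : ℕ := d * (r + 1) + 1
  set C : ℝ := 4 * D ^ 2 * Real.exp (2 * (D : ℝ) ^ 3)
  have hbound : ∀ᶠ n : ℕ in Filter.atTop, uniformWeights (Fin n)
      {w : Fin n → ℝ | Real.sqrt n * b n < |((greedySet (E n) w).card : ℝ) -
        ∫ w' : Fin n → ℝ, ((greedySet (E n) w').card : ℝ) ∂(uniformWeights (Fin n))|} ≤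
      ENNReal.ofReal (C / b n ^ 2) := by
    filter_upwards [Filter.eventually_gt_atTop 0] with n hn
    have hn' : (0 : ℝ) < n := by exact_mod_cast hn
    have hb' := hbpos n
    refine (measure_mono (Set.ofPred_subset_ofPred.2 fun w hw => le_of_lt hw)).trans
      ((meas_ge_le_variance_div_sq (memLp_card_greedySet (E n))
        (c := Real.sqrt n * b n) (by positivity)).trans (ENNReal.ofReal_le_ofReal ?_))
    have hvar := variance_card_greedySet_le (card_closedNbhd_le (huniform n) (hdeg n))
    rw [Fintype.card_fin] at hvar
    rw [mul_pow, Real.sq_sqrt hn'.le, div_le_div_iff₀ (by positivity) (by positivity)]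
    calc _ ≤ (n * C) * b n ^ 2 := by gcongr
      _ = _ := by ring
  have hlim : Filter.Tendsto (fun n => ENNReal.ofReal (C / b n ^ 2)) Filter.atTop (nhds 0) := by
    rw [← ENNReal.ofReal_zero]
    exact ENNReal.tendsto_ofReal <| tendsto_const_nhds.div_atTop <|
      (Filter.tendsto_pow_atTop two_ne_zero).comp hb
  exact tendsto_of_tendsto_of_tendsto_of_le_of_le' tendsto_const_nhds hlim
    (.of_forall fun _ => zero_le) hbound
end

section
/- Fix integers r ≥ 1 and d ≥ 2. For h ≥ 0, let γ_h denote the root of T(d,h) and γ̃_h the root of T̃(d,h), and equip each tree's vertices with i.i.d. Uniform[0,1] weights. Then both limits lim_{h→∞} P[γ_h ∈ I(T(d,h))] and lim_{h→∞} P[γ̃_h ∈ I(T̃(d,h))] exist. -/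
open MeasureTheory Finset

/-- `(V, E)` together with the root `γ` and depth function `dep` is the `(r+1)`-uniform
rooted hypertree in which the root has `dRoot` descending edges, every other non-leaf
vertex has `dOther` descending edges, and every leaf has depth `h`.  Each edge consists of
a unique vertex closest to the root together with `r` vertices one level deeper, and every
non-root vertex lies in exactly one edge in which it is not the vertex closest to the
root. -/
def IsRegularRootedHypertree {V : Type*} [Fintype V] [DecidableEq V] (r : ℕ)
    (E : Finset (Finset V)) (γ : V) (dep : V → ℕ) (dRoot dOther h : ℕ) : Prop :=
  dep γ = 0 ∧ (∀ v, dep v = 0 → v = γ) ∧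
  (∀ e ∈ E, e.card = r + 1 ∧ ∃ t ∈ e, ∀ u ∈ e, u ≠ t → dep u = dep t + 1) ∧
  (∀ v : V, v ≠ γ → (E.filter (fun e => v ∈ e ∧ ∃ u ∈ e, dep u < dep v)).card = 1) ∧
  (∀ v : V, dep v ≤ h) ∧
  (∀ v : V, dep v < h →
    (E.filter (fun e => v ∈ e ∧ ∀ u ∈ e, dep v ≤ dep u)).card =
      if v = γ then dRoot else dOther) ∧
  (∀ v : V, dep v = h → (E.filter (fun e => v ∈ e ∧ ∀ u ∈ e, dep v ≤ dep u)).card = 0)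

namespace RootSelection

open ProbabilityTheory Filter Topology
open scoped ENNReal

/-- The uniform distribution on `[0, 1]`. -/
noncomputable def unif : Measure ℝ := volume.restrict (Set.Icc (0 : ℝ) 1)

instance : IsProbabilityMeasure unif :=
  ⟨by simp [unif]⟩

lemma unif_le_volume : unif ≤ volume := Measure.restrict_le_self

/-- The probability that the root of the tree of height `k` in which every non-leaf vertex has
`m` descending edges is selected and has weight larger than `x`. -/
noncomputable def tailProb (r m : ℕ) : ℕ → ℝ → ℝ≥0∞
  | 0, x => unif (Set.Ioi x)
  | k + 1, x => ∫⁻ t in Set.Ioi x, (1 - tailProb r m k t ^ r) ^ m ∂unif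

lemma one_sub_pow_pow_le_one (a : ℝ≥0∞) (r m : ℕ) : (1 - a ^ r) ^ m ≤ 1 :=
  pow_le_one₀ zero_le tsub_le_self

lemma tailProb_le_unif_Ioi (r m k : ℕ) (x : ℝ) : tailProb r m k x ≤ unif (Set.Ioi x) := by
  cases k with
  | zero => exact le_rfl
  | succ k =>
    calc tailProb r m (k + 1) x ≤ ∫⁻ _ in Set.Ioi x, 1 ∂unif :=
          lintegral_mono fun t => one_sub_pow_pow_le_one _ r m
      _ = unif (Set.Ioi x) := by simp

lemma tailProb_le_one (r m k : ℕ) (x : ℝ) : tailProb r m k x ≤ 1 :=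
  (tailProb_le_unif_Ioi r m k x).trans prob_le_one

lemma tailProb_ne_top (r m k : ℕ) (x : ℝ) : tailProb r m k x ≠ ∞ :=
  ((tailProb_le_one r m k x).trans_lt ENNReal.one_lt_top).ne

lemma toReal_tailProb_le_one (r m k : ℕ) (x : ℝ) : (tailProb r m k x).toReal ≤ 1 :=
  ENNReal.toReal_le_of_le_ofReal zero_le_one (by simpa using tailProb_le_one r m k x)

lemma tailProb_of_one_le (r m k : ℕ) {x : ℝ} (hx : 1 ≤ x) : tailProb r m k x = 0 := by
  refine le_antisymm ((tailProb_le_unif_Ioi r m k x).trans (le_of_eq ?_)) zero_le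
  have : Set.Ioi x ∩ Set.Icc (0 : ℝ) 1 = ∅ := by
    ext t
    simp only [Set.mem_inter_iff, Set.mem_Ioi, Set.mem_Icc, Set.mem_empty_iff_false, iff_false]
    intro h
    linarith [h.1, h.2.2]
  rw [unif, Measure.restrict_apply measurableSet_Ioi, this, measure_empty]

lemma antitone_tailProb (r m k : ℕ) : Antitone (tailProb r m k) := by
  intro x y hxy
  cases k with
  | zero => exact measure_mono (Set.Ioi_subset_Ioi hxy)
  | succ k => exact lintegral_mono_set (Set.Ioi_subset_Ioi hxy)

lemma measurable_tailProb (r m k : ℕ) : Measurable (tailProb r m k) :=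
  (antitone_tailProb r m k).measurable

lemma measurable_toReal_tailProb (r m k : ℕ) : Measurable fun x => (tailProb r m k x).toReal :=
  (measurable_tailProb r m k).ennreal_toReal

lemma toReal_one_sub_pow_pow (r m k : ℕ) (x : ℝ) :
    ((1 - tailProb r m k x ^ r) ^ m).toReal = (1 - (tailProb r m k x).toReal ^ r) ^ m := by
  rw [ENNReal.toReal_pow, ENNReal.toReal_sub_of_le (pow_le_one₀ zero_le (tailProb_le_one r m k x))
    ENNReal.one_ne_top, ENNReal.toReal_one, ENNReal.toReal_pow]

lemma toReal_tailProb_succ (r m k : ℕ) (x : ℝ) :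
    (tailProb r m (k + 1) x).toReal =
      ∫ t in Set.Ioi x, (1 - (tailProb r m k t).toReal ^ r) ^ m ∂unif := by
  rw [tailProb, ← integral_toReal]
  · simp_rw [toReal_one_sub_pow_pow]
  · exact (((measurable_tailProb r m k).pow_const r).const_sub 1 |>.pow_const m).aemeasurable
  · exact ae_of_all _ fun t => (one_sub_pow_pow_le_one _ r m).trans_lt ENNReal.one_lt_top

lemma abs_pow_sub_pow_le_of_mem_unitInterval {a b : ℝ} (ha : a ∈ Set.Icc (0 : ℝ) 1)
    (hb : b ∈ Set.Icc (0 : ℝ) 1) (n : ℕ) : |a ^ n - b ^ n| ≤ n * |a - b| := by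
  refine (abs_pow_sub_pow_le a b n).trans ?_
  rw [mul_comm (n : ℝ)]
  refine mul_le_of_le_one_right (by positivity) (pow_le_one₀ (by positivity) ?_)
  rw [abs_of_nonneg ha.1, abs_of_nonneg hb.1]
  exact max_le ha.2 hb.2

lemma abs_one_sub_pow_pow_sub_le {a b : ℝ} (ha : a ∈ Set.Icc (0 : ℝ) 1)
    (hb : b ∈ Set.Icc (0 : ℝ) 1) (r m : ℕ) :
    |(1 - a ^ r) ^ m - (1 - b ^ r) ^ m| ≤ (m * r + 1) * |a - b| := by
  have mem {c : ℝ} (hc : c ∈ Set.Icc (0 : ℝ) 1) : 1 - c ^ r ∈ Set.Icc (0 : ℝ) 1 :=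
    ⟨sub_nonneg.2 (pow_le_one₀ hc.1 hc.2), sub_le_self _ (pow_nonneg hc.1 r)⟩
  calc |(1 - a ^ r) ^ m - (1 - b ^ r) ^ m|
      ≤ m * |(1 - a ^ r) - (1 - b ^ r)| := abs_pow_sub_pow_le_of_mem_unitInterval (mem ha) (mem hb) m
    _ = m * |a ^ r - b ^ r| := by rw [sub_sub_sub_cancel_left, abs_sub_comm]
    _ ≤ m * (r * |a - b|) := by
        gcongr
        exact abs_pow_sub_pow_le_of_mem_unitInterval ha hb r
    _ ≤ (m * r + 1) * |a - b| := by nlinarith [abs_nonneg (a - b)]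

lemma toReal_tailProb_mem (r m k : ℕ) (x : ℝ) :
    (tailProb r m k x).toReal ∈ Set.Icc (0 : ℝ) 1 :=
  ⟨ENNReal.toReal_nonneg, toReal_tailProb_le_one r m k x⟩

lemma abs_tailProb_succ_sub_le (r m k : ℕ) (x : ℝ) :
    |(tailProb r m (k + 1) x).toReal - (tailProb r m k x).toReal| ≤
      Real.exp (2 * (m * r + 1)) * (1 / 2) ^ k * Real.exp (-(2 * (m * r + 1)) * x) := by
  set c : ℝ := m * r + 1 with hc
  have hc0 : 0 < c := by positivity
  induction k generalizing x with
  | zero =>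
    rcases le_or_gt 1 x with hx | hx
    · rw [tailProb_of_one_le r m _ hx, tailProb_of_one_le r m _ hx]
      simp only [sub_self, abs_zero]
      positivity
    · have h0 := toReal_tailProb_mem r m 0 x
      have h1 := toReal_tailProb_mem r m 1 x
      rw [pow_zero, mul_one, ← Real.exp_add]
      calc _ ≤ (1 : ℝ) := abs_sub_le_iff.2 ⟨by linarith [h0.1, h1.2], by linarith [h0.2, h1.1]⟩
        _ ≤ _ := Real.one_le_exp (by nlinarith)
  | succ k ih =>
    have hInt (j : ℕ) : Integrable (fun t => (1 - (tailProb r m j t).toReal ^ r) ^ m)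
        (unif.restrict (Set.Ioi x)) := by
      refine Integrable.of_bound
        (((measurable_toReal_tailProb r m j).pow_const r).const_sub 1 |>.pow_const m
          ).aestronglyMeasurable 1 (ae_of_all _ fun t => ?_)
      have h := toReal_tailProb_mem r m j t
      have h' : 0 ≤ 1 - (tailProb r m j t).toReal ^ r := sub_nonneg.2 (pow_le_one₀ h.1 h.2)
      rw [Real.norm_eq_abs, abs_of_nonneg (pow_nonneg h' m)]
      exact pow_le_one₀ h' (sub_le_self _ (pow_nonneg h.1 r))
    have hexp : IntegrableOn (fun t => c * (Real.exp (2 * c) * (1 / 2) ^ k *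
        Real.exp (-(2 * c) * t))) (Set.Ioi x) :=
      ((integrableOn_exp_mul_Ioi (by linarith) x).const_mul _).const_mul _
    have hle : unif.restrict (Set.Ioi x) ≤ volume.restrict (Set.Ioi x) :=
      Measure.restrict_mono le_rfl unif_le_volume
    rw [toReal_tailProb_succ, toReal_tailProb_succ r m k, ← integral_sub (hInt _) (hInt _)]
    calc _ ≤ ∫ t in Set.Ioi x, |(1 - (tailProb r m (k + 1) t).toReal ^ r) ^ m -
            (1 - (tailProb r m k t).toReal ^ r) ^ m| ∂unif := abs_integral_le_integral_abs
      _ ≤ ∫ t in Set.Ioi x, c * (Real.exp (2 * c) * (1 / 2) ^ k *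
            Real.exp (-(2 * c) * t)) ∂unif := by
          refine integral_mono ((hInt _).sub (hInt _)).abs (Integrable.mono_measure hexp hle)
            fun t => ?_
          refine (abs_one_sub_pow_pow_sub_le (toReal_tailProb_mem r m _ t)
            (toReal_tailProb_mem r m _ t) r m).trans ?_
          exact mul_le_mul_of_nonneg_left (ih t) hc0.le
      _ ≤ ∫ t in Set.Ioi x, c * (Real.exp (2 * c) * (1 / 2) ^ k * Real.exp (-(2 * c) * t)) :=
          integral_mono_measure hle (ae_of_all _ fun t => by positivity) hexp
      _ = _ := by
          rw [integral_const_mul, integral_const_mul, integral_exp_mul_Ioi (by linarith)]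
          field_simp
          ring

lemma exists_tendsto_tailProb (r m : ℕ) (x : ℝ) :
    ∃ l, Tendsto (fun k => tailProb r m k x) atTop (𝓝 l) := by
  have hcauchy : CauchySeq fun k => (tailProb r m k x).toReal := by
    refine cauchySeq_of_le_geometric (1 / 2)
      (Real.exp (2 * (m * r + 1)) * Real.exp (-(2 * (m * r + 1)) * x)) (by norm_num) fun k => ?_
    rw [dist_comm, Real.dist_eq, mul_right_comm]
    exact abs_tailProb_succ_sub_le r m k x
  obtain ⟨l, hl⟩ := cauchySeq_tendsto_of_complete hcauchy
  refine ⟨ENNReal.ofReal l, (ENNReal.tendsto_ofReal hl).congr fun k => ?_⟩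
  exact ENNReal.ofReal_toReal (tailProb_ne_top r m k x)

lemma exists_tendsto_lintegral_tailProb (r m n : ℕ) :
    ∃ L : ℝ, Tendsto (fun k => (∫⁻ t, (1 - tailProb r m k t ^ r) ^ n ∂unif).toReal)
      atTop (𝓝 L) := by
  choose l hl using exists_tendsto_tailProb r m
  refine ⟨(∫⁻ t, (1 - l t ^ r) ^ n ∂unif).toReal, (ENNReal.tendsto_toReal ?_).comp ?_⟩
  · refine ((lintegral_mono fun t => one_sub_pow_pow_le_one (l t) r n).trans_lt ?_).ne
    simp
  · refine tendsto_lintegral_of_dominated_convergence (fun _ => 1) (fun k => ?_)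
      (fun k => ae_of_all _ fun t => one_sub_pow_pow_le_one _ r n) (by simp)
      (ae_of_all _ fun t => ?_)
    · exact ((measurable_tailProb r m k).pow_const r).const_sub 1 |>.pow_const n
    · have hcont : Continuous fun a : ℝ≥0∞ => (1 - a ^ r) ^ n :=
        (ENNReal.continuous_pow n).comp
          ((ENNReal.continuous_sub_left ENNReal.one_ne_top).comp (ENNReal.continuous_pow r))
      exact (hcont.tendsto _).comp (hl t)

section Product

variable {V : Type*}

lemma uniformWeights_eq_pi [Fintype V] : uniformWeights V = Measure.pi fun _ : V => unif := rfl

instance [Fintype V] : IsProbabilityMeasure (uniformWeights V) := by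
  rw [uniformWeights_eq_pi]
  infer_instance

lemma exists_preimage_restrict {p : (V → ℝ) → Prop} {S : Finset V}
    (hp : MeasurableSet {w | p w}) (hS : DependsOn p S) :
    ∃ A : Set (S → ℝ), MeasurableSet A ∧ {w | p w} = (fun w (i : S) => w i) ⁻¹' A := by
  classical
  let extend : (S → ℝ) → V → ℝ := fun z i => if h : i ∈ S then z ⟨i, h⟩ else 0
  have hextend : Measurable extend := by
    refine measurable_pi_lambda _ fun i => ?_
    by_cases h : i ∈ S
    · simpa [extend, h] using measurable_pi_apply (⟨i, h⟩ : S)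
    · simp [extend, h]
  refine ⟨extend ⁻¹' {w | p w}, hextend hp, ?_⟩
  ext w
  have : p w = p (extend fun i : S => w i) := hS fun i hi => by
    have hi : i ∈ S := hi
    simp [extend, hi]
  simp [this]

lemma measurable_update_prod [DecidableEq V] (v : V) :
    Measurable fun z : ℝ × (V → ℝ) => Function.update z.2 v z.1 := by
  refine measurable_pi_lambda _ fun i => ?_
  rcases eq_or_ne i v with rfl | h
  · simpa using measurable_fst
  · simpa [h, Function.comp_def] using (measurable_pi_apply i).comp measurable_snd

variable [Fintype V]

lemma measure_and_eq_mul {p q : (V → ℝ) → Prop} {S T : Finset V} (hST : Disjoint S T)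
    (hp : MeasurableSet {w | p w}) (hq : MeasurableSet {w | q w})
    (hS : DependsOn p S) (hT : DependsOn q T) :
    uniformWeights V {w | p w ∧ q w} =
      uniformWeights V {w | p w} * uniformWeights V {w | q w} := by
  obtain ⟨A, hA, hpA⟩ := exists_preimage_restrict hp hS
  obtain ⟨B, hB, hqB⟩ := exists_preimage_restrict hq hT
  have hind : iIndepFun (fun (i : V) (w : V → ℝ) => w i) (uniformWeights V) :=
    iIndepFun_pi (μ := fun _ : V => unif) (X := fun _ x => x) fun _ => aemeasurable_id
  have h := (hind.indepFun_finset S T hST fun i => measurable_pi_apply i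
    ).measure_inter_preimage_eq_mul A B hA hB
  rwa [← hpA, ← hqB] at h

lemma measure_forall_eq_prod {ι : Type*} {p : ι → (V → ℝ) → Prop} {S : ι → Finset V}
    (J : Finset ι) (hS : (J : Set ι).PairwiseDisjoint S)
    (hp : ∀ j ∈ J, MeasurableSet {w | p j w}) (hpS : ∀ j ∈ J, DependsOn (p j) (S j)) :
    uniformWeights V {w | ∀ j ∈ J, p j w} = ∏ j ∈ J, uniformWeights V {w | p j w} := by
  classical
  induction J using Finset.induction_on with
  | empty => simp
  | insert a J ha ih =>
    rw [Finset.prod_insert ha, ← ih (hS.subset (by simp)) (fun j hj => hp j (by simp [hj]))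
      (fun j hj => hpS j (by simp [hj]))]
    simp_rw [Finset.forall_mem_insert]
    refine measure_and_eq_mul (S := S a) (T := J.biUnion S) ?_ (hp a (by simp)) ?_
      (hpS a (by simp)) ?_
    · rw [Finset.disjoint_biUnion_right]
      exact fun j hj => hS (by simp) (by simp [hj]) (by rintro rfl; exact ha hj)
    · rw [show {w | ∀ j ∈ J, p j w} = ⋂ j ∈ J, {w | p j w} by ext; simp]
      exact J.measurableSet_biInter fun j hj => hp j (by simp [hj])
    · intro w w' h
      refine propext (forall₂_congr fun j hj => ?_)
      rw [hpS j (by simp [hj]) fun i hi => h i ?_]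
      exact Finset.mem_coe.2 (Finset.mem_biUnion.2 ⟨j, hj, hi⟩)

variable [DecidableEq V]

lemma map_update_prod_uniformWeights (v : V) :
    (unif.prod (uniformWeights V)).map (fun z => Function.update z.2 v z.1) =
      uniformWeights V := by
  symm
  refine Measure.pi_eq fun s hs => ?_
  rw [Measure.map_apply (measurable_update_prod v) (.univ_pi hs)]
  have : (fun z : ℝ × (V → ℝ) => Function.update z.2 v z.1) ⁻¹' Set.univ.pi s =
      s v ×ˢ Set.univ.pi (Function.update s v Set.univ) := by
    ext z
    simp only [Set.mem_preimage, Set.mem_univ_pi, Set.mem_prod]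
    constructor
    · refine fun h => ⟨by simpa using h v, fun i => ?_⟩
      rcases eq_or_ne i v with rfl | hi
      · simp
      · simpa [hi] using h i
    · intro h i
      rcases eq_or_ne i v with rfl | hi
      · simpa using h.1
      · simpa [hi] using h.2 i
  rw [this, Measure.prod_prod, uniformWeights_eq_pi, Measure.pi_pi,
    ← Finset.mul_prod_erase univ _ (mem_univ v), ← Finset.mul_prod_erase univ _ (mem_univ v)]
  simp only [Function.update_self, measure_univ, one_mul]
  congr 1
  exact Finset.prod_congr rfl fun i hi => by rw [Function.update_of_ne (ne_of_mem_erase hi)]; rfl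

lemma measure_eq_lintegral_update (v : V) {p : (V → ℝ) → Prop} (hp : MeasurableSet {w | p w}) :
    uniformWeights V {w | p w} =
      ∫⁻ t, uniformWeights V {w | p (Function.update w v t)} ∂unif := by
  conv_lhs => rw [← map_update_prod_uniformWeights v]
  rw [Measure.map_apply (measurable_update_prod v) hp,
    Measure.prod_apply (measurable_update_prod v hp)]
  rfl

end Product

section Tree

variable {V : Type*} [Fintype V] [DecidableEq V]

/-- The edges of `E` in which `v` is a vertex of smallest depth. -/
def descEdges (E : Finset (Finset V)) (dep : V → ℕ) (v : V) : Finset (Finset V) :=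
  E.filter fun e => v ∈ e ∧ ∀ u ∈ e, dep v ≤ dep u

/-- Selection of `v` by the greedy algorithm when only `k` levels of descending edges below `v`
are taken into account. -/
def branchSelect (E : Finset (Finset V)) (dep : V → ℕ) : ℕ → V → (V → ℝ) → Prop
  | 0, _, _ => True
  | k + 1, v, w => ∀ e ∈ descEdges E dep v,
      ¬ ∀ u ∈ e.erase v, w v < w u ∧ branchSelect E dep k u w

lemma measurableSet_branchSelect (E : Finset (Finset V)) (dep : V → ℕ) (k : ℕ) (v : V) :
    MeasurableSet {w | branchSelect E dep k v w} := by
  induction k generalizing v with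
  | zero => simp [branchSelect]
  | succ k ih =>
    have : {w | branchSelect E dep (k + 1) v w} = ⋂ e ∈ descEdges E dep v,
        (⋂ u ∈ e.erase v, {w : V → ℝ | w v < w u} ∩ {w | branchSelect E dep k u w})ᶜ := by
      ext w
      simp [branchSelect, and_assoc]
    rw [this]
    refine Finset.measurableSet_biInter _ fun e _ => MeasurableSet.compl ?_
    exact Finset.measurableSet_biInter _ fun u _ =>
      (measurableSet_lt (measurable_pi_apply v) (measurable_pi_apply u)).inter (ih u)

lemma measurableSet_lt_and_branchSelect (E : Finset (Finset V)) (dep : V → ℕ)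
    (k : ℕ) (u : V) (t : ℝ) :
    MeasurableSet {w : V → ℝ | t < w u ∧ branchSelect E dep k u w} :=
  (measurableSet_lt measurable_const (measurable_pi_apply u)).inter
    (measurableSet_branchSelect E dep k u)

open scoped Classical in
/-- The vertex closest to the root in an edge in which `u` is not this closest vertex. -/
noncomputable def parent (E : Finset (Finset V)) (dep : V → ℕ) (u : V) : V :=
  if h : ∃ v, ∃ e ∈ descEdges E dep v, u ∈ e.erase v then h.choose else u

/-- The vertices of the branch rooted at `v`. -/
noncomputable def branch (E : Finset (Finset V)) (dep : V → ℕ) (v : V) : Finset V :=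
  univ.filter fun u => dep v ≤ dep u ∧ (parent E dep)^[dep u - dep v] u = v

lemma mem_branch_self (E : Finset (Finset V)) (dep : V → ℕ) (v : V) : v ∈ branch E dep v := by
  simp [branch]

lemma disjoint_branch (E : Finset (Finset V)) (dep : V → ℕ) {u v : V} (huv : u ≠ v)
    (hdep : dep u = dep v) : Disjoint (branch E dep u) (branch E dep v) := by
  rw [Finset.disjoint_left]
  intro x hu hv
  simp only [branch, mem_filter, mem_univ, true_and] at hu hv
  exact huv (hu.2.symm.trans (hdep ▸ hv.2))

variable {r dRoot dOther h : ℕ} {E : Finset (Finset V)} {γ : V} {dep : V → ℕ}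
  (hT : IsRegularRootedHypertree r E γ dep dRoot dOther h)

include hT

lemma card_of_mem_descEdges {e : Finset V} {v : V} (he : e ∈ descEdges E dep v) :
    (e.erase v).card = r := by
  obtain ⟨heE, hve, -⟩ := mem_filter.1 he
  rw [card_erase_of_mem hve, (hT.2.2.1 e heE).1, Nat.add_sub_cancel]

lemma dep_of_mem_descEdges {e : Finset V} {u v : V} (he : e ∈ descEdges E dep v)
    (hu : u ∈ e.erase v) : dep u = dep v + 1 := by
  obtain ⟨heE, hve, hmin⟩ := mem_filter.1 he
  obtain ⟨-, t, ht, hdep⟩ := hT.2.2.1 e heE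
  have hvt : v = t := by
    by_contra hvt
    have := hdep v hve hvt
    have := hmin t ht
    omega
  rw [hvt]
  exact hdep u (mem_of_mem_erase hu) (hvt ▸ ne_of_mem_erase hu)

lemma edge_unique {e e' : Finset V} {u : V} (he : e ∈ E) (he' : e' ∈ E) (hu : u ∈ e)
    (hu' : u ∈ e') (hx : ∃ x ∈ e, dep x < dep u) (hx' : ∃ x ∈ e', dep x < dep u) : e = e' := by
  have huγ : u ≠ γ := by
    rintro rfl
    obtain ⟨x, -, hx⟩ := hx
    rw [hT.1] at hx
    exact Nat.not_lt_zero _ hx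
  exact card_le_one.1 (hT.2.2.2.1 u huγ).le e (mem_filter.2 ⟨he, hu, hx⟩) e'
    (mem_filter.2 ⟨he', hu', hx'⟩)

lemma descEdges_unique {e e' : Finset V} {u v v' : V} (he : e ∈ descEdges E dep v)
    (he' : e' ∈ descEdges E dep v') (hu : u ∈ e.erase v) (hu' : u ∈ e'.erase v') :
    e = e' ∧ v = v' := by
  have h := dep_of_mem_descEdges hT he hu
  have h' := dep_of_mem_descEdges hT he' hu'
  obtain ⟨heE, hve, hmin⟩ := mem_filter.1 he
  obtain ⟨heE', hve', hmin'⟩ := mem_filter.1 he'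
  have hee : e = e' := edge_unique hT heE heE' (mem_of_mem_erase hu) (mem_of_mem_erase hu')
    ⟨v, hve, by omega⟩ ⟨v', hve', by omega⟩
  refine ⟨hee, ?_⟩
  by_contra hvv
  have := dep_of_mem_descEdges hT he (mem_erase.2 ⟨Ne.symm hvv, hee ▸ hve'⟩)
  omega

lemma parent_eq {e : Finset V} {u v : V} (he : e ∈ descEdges E dep v) (hu : u ∈ e.erase v) :
    parent E dep u = v := by
  have h : ∃ v, ∃ e ∈ descEdges E dep v, u ∈ e.erase v := ⟨v, e, he, hu⟩
  rw [parent, dif_pos h]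
  obtain ⟨e', he', hu'⟩ := h.choose_spec
  exact (descEdges_unique hT he' he hu' hu).2

lemma branch_subset {e : Finset V} {u v : V} (he : e ∈ descEdges E dep v)
    (hu : u ∈ e.erase v) : branch E dep u ⊆ (branch E dep v).erase v := by
  intro x hx
  have hdep := dep_of_mem_descEdges hT he hu
  simp only [branch, mem_filter, mem_univ, true_and, mem_erase] at hx ⊢
  refine ⟨?_, by omega, ?_⟩
  · rintro rfl
    omega
  · rw [show dep x - dep v = (dep x - dep u) + 1 by omega, Function.iterate_succ_apply', hx.2,
      parent_eq hT he hu]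

lemma dependsOn_branchSelect (k : ℕ) (v : V) :
    DependsOn (branchSelect E dep k v) (branch E dep v) := by
  induction k generalizing v with
  | zero => exact fun w w' _ => rfl
  | succ k ih =>
    intro w w' hw
    refine propext (forall₂_congr fun e he => not_congr (forall₂_congr fun u hu => ?_))
    have hsub (x) (hx : x ∈ branch E dep u) : x ∈ branch E dep v :=
      mem_of_mem_erase (branch_subset hT he hu hx)
    rw [hw v (mem_branch_self E dep v), hw u (hsub u (mem_branch_self E dep u)),
      ih u fun x hx => hw x (hsub x hx)]

lemma greedySelect_iff_branchSelect (w : V → ℝ) (k : ℕ) (v : V) (hk : dep v + k = h)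
    (hup : ∀ e ∈ E, v ∈ e → (∃ x ∈ e, dep x < dep v) → ∃ x ∈ e, x ≠ v ∧ ¬ w v < w x) :
    greedySelect E w v ↔ branchSelect E dep k v w := by
  induction k generalizing v with
  | zero =>
    simp only [branchSelect, iff_true]
    rw [greedySelect]
    rintro ⟨e, he, hve, hlt, -⟩
    by_cases hx : ∃ x ∈ e, dep x < dep v
    · obtain ⟨x, hxe, hxv, hnot⟩ := hup e he hve hx
      exact hnot (hlt x hxe hxv)
    · push Not at hx
      have := card_eq_zero.1 (hT.2.2.2.2.2.2 v (by omega))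
      exact notMem_empty e (this ▸ mem_filter.2 ⟨he, hve, hx⟩)
  | succ k ih =>
    have key {e : Finset V} (he : e ∈ descEdges E dep v) {u : V} (hu : u ∈ e.erase v)
        (hlt : w v < w u) : greedySelect E w u ↔ branchSelect E dep k u w := by
      have hdep := dep_of_mem_descEdges hT he hu
      obtain ⟨heE, hve, -⟩ := mem_filter.1 he
      refine ih u (by omega) fun e' he' hue' hx => ?_
      obtain rfl := edge_unique hT he' heE hue' (mem_of_mem_erase hu) hx ⟨v, hve, by omega⟩
      exact ⟨v, hve, (ne_of_mem_erase hu).symm, hlt.asymm⟩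
    rw [greedySelect, branchSelect]
    push Not
    constructor
    · intro hgreedy e he
      obtain ⟨heE, hve, -⟩ := mem_filter.1 he
      by_contra! hall
      obtain ⟨u, hue, huv, hlt, hnot⟩ := hgreedy e heE hve fun u hue huv =>
        (hall u (mem_erase.2 ⟨huv, hue⟩)).1
      have hu : u ∈ e.erase v := mem_erase.2 ⟨huv, hue⟩
      exact hnot ((key he hu hlt).2 (hall u hu).2)
    · intro hbranch e heE hve hlt
      by_cases hx : ∃ x ∈ e, dep x < dep v
      · obtain ⟨x, hxe, hxv, hnot⟩ := hup e heE hve hx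
        exact absurd (hlt x hxe hxv) hnot
      · push Not at hx
        have he : e ∈ descEdges E dep v := mem_filter.2 ⟨heE, hve, hx⟩
        obtain ⟨u, hu, hnot⟩ := hbranch e he
        have hu' := mem_erase.1 hu
        have hvu := hlt u hu'.2 hu'.1
        exact ⟨u, hu'.2, hu'.1, hvu, fun hsel => hnot hvu ((key he hu hvu).1 hsel)⟩

lemma greedySelect_root_iff (w : V → ℝ) :
    greedySelect E w γ ↔ branchSelect E dep h γ w := by
  refine greedySelect_iff_branchSelect hT w h γ (by rw [hT.1, zero_add]) ?_
  rintro e - - ⟨x, -, hx⟩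
  rw [hT.1] at hx
  exact absurd hx (Nat.not_lt_zero _)

lemma branchSelect_update_iff (k : ℕ) (v : V) (w : V → ℝ) (t : ℝ) :
    branchSelect E dep (k + 1) v (Function.update w v t) ↔
      ∀ e ∈ descEdges E dep v, ¬ ∀ u ∈ e.erase v, t < w u ∧ branchSelect E dep k u w := by
  refine forall₂_congr fun e he => not_congr (forall₂_congr fun u hu => ?_)
  rw [Function.update_self, Function.update_of_ne (ne_of_mem_erase hu),
    dependsOn_branchSelect hT k u (x := Function.update w v t) (y := w) fun x hx => ?_]
  exact Function.update_of_ne (ne_of_mem_erase (branch_subset hT he hu hx)) _ _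

lemma dependsOn_lt_and_branchSelect (k : ℕ) (u : V) (t : ℝ) :
    DependsOn (fun w : V → ℝ => t < w u ∧ branchSelect E dep k u w) (branch E dep u) := by
  intro w w' hw
  dsimp only
  rw [hw u (mem_branch_self E dep u), dependsOn_branchSelect hT k u hw]

lemma measure_branchSelect_update {m k : ℕ} {v : V} (t : ℝ)
    (hchild : ∀ e ∈ descEdges E dep v, ∀ u ∈ e.erase v,
      uniformWeights V {w | t < w u ∧ branchSelect E dep k u w} = tailProb r m k t) :
    uniformWeights V {w | branchSelect E dep (k + 1) v (Function.update w v t)} =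
      (1 - tailProb r m k t ^ r) ^ (descEdges E dep v).card := by
  have hmeas (e : Finset V) :
      MeasurableSet {w : V → ℝ | ∀ u ∈ e.erase v, t < w u ∧ branchSelect E dep k u w} := by
    rw [show {w : V → ℝ | ∀ u ∈ e.erase v, t < w u ∧ branchSelect E dep k u w} =
      ⋂ u ∈ e.erase v, {w | t < w u ∧ branchSelect E dep k u w} by ext; simp]
    exact Finset.measurableSet_biInter _ fun u _ => measurableSet_lt_and_branchSelect E dep k u t
  simp_rw [branchSelect_update_iff hT]
  rw [measure_forall_eq_prod (S := fun e => (e.erase v).biUnion (branch E dep))]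
  · refine Finset.prod_eq_pow_card fun e he => ?_
    rw [show {w : V → ℝ | ¬ ∀ u ∈ e.erase v, t < w u ∧ branchSelect E dep k u w} =
      {w | ∀ u ∈ e.erase v, t < w u ∧ branchSelect E dep k u w}ᶜ from rfl,
      prob_compl_eq_one_sub (hmeas e), measure_forall_eq_prod (S := branch E dep),
      Finset.prod_eq_pow_card (hchild e he), card_of_mem_descEdges hT he]
    · intro u hu u' hu' hne
      exact disjoint_branch E dep hne
        ((dep_of_mem_descEdges hT he hu).trans (dep_of_mem_descEdges hT he hu').symm)
    · exact fun u _ => measurableSet_lt_and_branchSelect E dep k u t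
    · exact fun u _ => dependsOn_lt_and_branchSelect hT k u t
  · intro e he e' he' hne
    rw [mem_coe] at he he'
    simp only [Function.onFun, disjoint_biUnion_left, disjoint_biUnion_right]
    intro u' hu' u hu
    refine disjoint_branch E dep ?_
      ((dep_of_mem_descEdges hT he hu).trans (dep_of_mem_descEdges hT he' hu').symm)
    rintro rfl
    exact hne (descEdges_unique hT he he' hu hu').1
  · exact fun e _ => (hmeas e).compl
  · intro e he w w' hw
    refine propext (not_congr (forall₂_congr fun u hu => ?_))
    exact (dependsOn_lt_and_branchSelect hT k u t fun x hx =>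
      hw x (Finset.mem_coe.2 (mem_biUnion.2 ⟨u, hu, hx⟩))).to_iff

lemma card_descEdges {v : V} (hv : dep v < h) :
    (descEdges E dep v).card = if v = γ then dRoot else dOther :=
  hT.2.2.2.2.2.1 v hv

lemma ne_root_of_mem_descEdges {e : Finset V} {u v : V} (he : e ∈ descEdges E dep v)
    (hu : u ∈ e.erase v) : u ≠ γ := by
  rintro rfl
  have := dep_of_mem_descEdges hT he hu
  rw [hT.1] at this
  omega

lemma measure_lt_and_branchSelect (k : ℕ) (v : V) (hvγ : v ≠ γ) (hk : dep v + k = h) (x : ℝ) :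
    uniformWeights V {w | x < w v ∧ branchSelect E dep k v w} = tailProb r dOther k x := by
  induction k generalizing v x with
  | zero =>
    rw [measure_eq_lintegral_update v (measurableSet_lt_and_branchSelect E dep 0 v x), tailProb,
      ← lintegral_indicator_one measurableSet_Ioi]
    refine lintegral_congr fun t => ?_
    by_cases ht : x < t <;> simp [branchSelect, ht]
  | succ k ih =>
    rw [measure_eq_lintegral_update v (measurableSet_lt_and_branchSelect E dep (k + 1) v x),
      tailProb, ← lintegral_indicator measurableSet_Ioi]
    refine lintegral_congr fun t => ?_
    by_cases ht : x < t
    · simp only [Function.update_self, ht, true_and, Set.mem_Ioi, Set.indicator_of_mem]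
      rw [measure_branchSelect_update hT (m := dOther) t fun e he u hu => ?_,
        card_descEdges hT (by omega), if_neg hvγ]
      exact ih u (ne_root_of_mem_descEdges hT he hu)
        (by have := dep_of_mem_descEdges hT he hu; omega) t
    · simp [ht]

end Tree

lemma measure_greedySelect_root {V : Type*} [Fintype V] [DecidableEq V]
    {r dRoot dOther k : ℕ} {E : Finset (Finset V)} {γ : V} {dep : V → ℕ}
    (hT : IsRegularRootedHypertree r E γ dep dRoot dOther (k + 1)) :
    uniformWeights V {w | greedySelect E w γ} =
      ∫⁻ t, (1 - tailProb r dOther k t ^ r) ^ dRoot ∂unif := by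
  simp_rw [greedySelect_root_iff hT]
  rw [measure_eq_lintegral_update γ (measurableSet_branchSelect E dep (k + 1) γ)]
  refine lintegral_congr fun t => ?_
  rw [measure_branchSelect_update hT (m := dOther) t fun e he u hu => ?_,
    card_descEdges hT (by rw [hT.1]; omega), if_pos rfl]
  refine measure_lt_and_branchSelect hT k u (ne_root_of_mem_descEdges hT he hu) ?_ t
  have := dep_of_mem_descEdges hT he hu
  rw [hT.1] at this
  omega

lemma exists_tendsto_measure_greedySelect_root {r dRoot dOther : ℕ} {V : ℕ → Type*}
    [∀ h, Fintype (V h)] [∀ h, DecidableEq (V h)] {E : ∀ h, Finset (Finset (V h))}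
    {γ : ∀ h, V h} {dep : ∀ h, V h → ℕ}
    (hT : ∀ h, IsRegularRootedHypertree r (E h) (γ h) (dep h) dRoot dOther h) :
    ∃ L : ℝ, Tendsto
      (fun h => (uniformWeights (V h) {w | greedySelect (E h) w (γ h)}).toReal) atTop (𝓝 L) := by
  obtain ⟨L, hL⟩ := exists_tendsto_lintegral_tailProb r dOther dRoot
  refine ⟨L, (tendsto_add_atTop_iff_nat 1).1 (hL.congr fun k => ?_)⟩
  rw [measure_greedySelect_root (hT (k + 1))]

end RootSelection

theorem root_selection_probability_limits_exist
    (r d : ℕ) (hr : 1 ≤ r) (hd : 2 ≤ d)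
    (VT : ℕ → Type) [∀ h, Fintype (VT h)] [∀ h, DecidableEq (VT h)]
    (ET : ∀ h : ℕ, Finset (Finset (VT h))) (γ : ∀ h : ℕ, VT h) (dep : ∀ h : ℕ, VT h → ℕ)
    (htree : ∀ h : ℕ, IsRegularRootedHypertree r (ET h) (γ h) (dep h) d d h)
    (VT' : ℕ → Type) [∀ h, Fintype (VT' h)] [∀ h, DecidableEq (VT' h)]
    (ET' : ∀ h : ℕ, Finset (Finset (VT' h))) (γ' : ∀ h : ℕ, VT' h)
    (dep' : ∀ h : ℕ, VT' h → ℕ)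
    (htree' : ∀ h : ℕ, IsRegularRootedHypertree r (ET' h) (γ' h) (dep' h) d (d - 1) h) :
    (∃ L : ℝ, Filter.Tendsto
      (fun h : ℕ =>
        ((uniformWeights (VT h)) {w : VT h → ℝ | greedySelect (ET h) w (γ h)}).toReal)
      Filter.atTop (nhds L)) ∧
    (∃ L : ℝ, Filter.Tendsto
      (fun h : ℕ =>
        ((uniformWeights (VT' h)) {w : VT' h → ℝ | greedySelect (ET' h) w (γ' h)}).toReal)
      Filter.atTop (nhds L)) := by
  exact ⟨RootSelection.exists_tendsto_measure_greedySelect_root htree,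
    RootSelection.exists_tendsto_measure_greedySelect_root htree'⟩
end

section
/- Let r ≥ 1 and d ≥ 2 be integers and let G be an (r+1)-uniform linear hypergraph on n vertices with maximum degree at most d. Let I(G) be the random independent set produced by the randomized greedy algorithm on G. Then Var[|I(G)|] ≤ 3·d²·r²·e^{r²(d−1)³}·n. -/
open MeasureTheory Finset

lemma variance_eq_sub_of_bounded {Z : Type*} [MeasurableSpace Z] (ρ : Measure Z)
    [IsProbabilityMeasure ρ] {f : Z → ℝ} {D : ℝ} (hf : Measurable f) (hD : ∀ z, |f z| ≤ D) :
    ProbabilityTheory.variance f ρ = (∫ z, f z ^ 2 ∂ρ) - (∫ z, f z ∂ρ) ^ 2 :=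
  ProbabilityTheory.variance_eq_sub (MemLp.of_bound hf.aestronglyMeasurable D (ae_of_all _ hD))

/-- Conditioning form of the Efron–Stein inequality on a product of two probability spaces. -/
lemma variance_prod_le {X Y : Type*} [MeasurableSpace X] [MeasurableSpace Y]
    (μ : Measure X) (ν : Measure Y) [IsProbabilityMeasure μ] [IsProbabilityMeasure ν]
    {F : X × Y → ℝ} {g : Y → ℝ} {C : ℝ} (hF : Measurable F) (hg : Measurable g)
    (hFC : ∀ z, |F z| ≤ C) (hgC : ∀ y, |g y| ≤ C) :
    ProbabilityTheory.variance F (μ.prod ν) ≤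
      (∫ z, (F z - g z.2) ^ 2 ∂(μ.prod ν)) +
        ∫ x, ProbabilityTheory.variance (fun y => F (x, y)) ν ∂μ := by
  have hC : ∀ {t : ℝ}, |t| ≤ C → ‖t ^ 2‖ ≤ C ^ 2 := fun {t} ht => by
    rw [Real.norm_eq_abs, abs_pow]; exact pow_le_pow_left₀ (abs_nonneg _) ht 2
  have hFx : ∀ x, Measurable fun y => F (x, y) := fun x => hF.comp measurable_prodMk_left
  have iF : Integrable F (μ.prod ν) :=
    Integrable.of_bound hF.aestronglyMeasurable C (ae_of_all _ hFC)
  have iF2 : Integrable (fun z => F z ^ 2) (μ.prod ν) :=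
    Integrable.of_bound (hF.pow_const 2).aestronglyMeasurable (C ^ 2)
      (ae_of_all _ fun z => hC (hFC z))
  have hD : ∀ z, |F z - g z.2| ≤ C + C := fun z =>
    (abs_sub _ _).trans (add_le_add (hFC z) (hgC _))
  have mD : Measurable fun z => F z - g z.2 := hF.sub (hg.comp measurable_snd)
  have iD2 : Integrable (fun z => (F z - g z.2) ^ 2) (μ.prod ν) := by
    refine Integrable.of_bound (mD.pow_const 2).aestronglyMeasurable ((C + C) ^ 2)
      (ae_of_all _ fun z => ?_)
    rw [Real.norm_eq_abs, abs_pow]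
    exact pow_le_pow_left₀ (abs_nonneg _) (hD z) 2
  set m : X → ℝ := fun x => ∫ y, F (x, y) ∂ν with hm
  have mm : StronglyMeasurable m := hF.stronglyMeasurable.integral_prod_right'
  have hmC : ∀ x, |m x| ≤ C := fun x => by
    have := norm_integral_le_of_norm_le_const (μ := ν) (f := fun y => F (x, y)) (C := C)
      (ae_of_all _ fun y => hFC (x, y))
    simpa using this
  have im : Integrable m μ := iF.integral_prod_left
  have im2 : Integrable (fun x => m x ^ 2) μ :=
    Integrable.of_bound (mm.measurable.pow_const 2).aestronglyMeasurable (C ^ 2)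
      (ae_of_all _ fun z => hC (hmC z))
  have hvar : ∀ x, ProbabilityTheory.variance (fun y => F (x, y)) ν =
      (∫ y, F (x, y) ^ 2 ∂ν) - m x ^ 2 := fun x =>
    variance_eq_sub_of_bounded ν (hFx x) fun y => hFC (x, y)
  set G : ℝ := ∫ y, g y ∂ν with hG
  have ig : Integrable g ν := Integrable.of_bound hg.aestronglyMeasurable C (ae_of_all _ hgC)
  have jensen : ∀ x, (m x - G) ^ 2 ≤ ∫ y, (F (x, y) - g y) ^ 2 ∂ν := fun x => by
    have h0 := ProbabilityTheory.variance_nonneg (fun y => F (x, y) - g y) ν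
    rw [variance_eq_sub_of_bounded ν (f := fun y => F (x, y) - g y) ((hFx x).sub hg)
      fun y => hD (x, y)] at h0
    have h1 : (∫ y, (F (x, y) - g y) ∂ν) = m x - G :=
      integral_sub (Integrable.of_bound (hFx x).aestronglyMeasurable C
        (ae_of_all _ fun y => hFC (x, y))) ig
    rw [h1] at h0
    linarith
  have hint : ∫ x, (m x - G) ^ 2 ∂μ ≤ ∫ z, (F z - g z.2) ^ 2 ∂(μ.prod ν) := by
    rw [integral_prod _ iD2]
    refine integral_mono_of_nonneg (ae_of_all _ fun x => sq_nonneg _)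
      iD2.integral_prod_left (ae_of_all _ jensen)
  have hexp : ∫ x, (m x - G) ^ 2 ∂μ = (∫ x, m x ^ 2 ∂μ) - 2 * G * (∫ x, m x ∂μ) + G ^ 2 := by
    have : ∀ x, (m x - G) ^ 2 = m x ^ 2 - 2 * G * m x + G ^ 2 := fun x => by ring
    simp_rw [this]
    rw [integral_add (f := fun x => m x ^ 2 - 2 * G * m x) (im2.sub (im.const_mul _))
        (integrable_const _),
      integral_sub im2 (im.const_mul _), integral_const_mul]
    simp
  rw [variance_eq_sub_of_bounded _ hF hFC]
  simp only [hvar]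
  rw [integral_sub iF2.integral_prod_left im2, ← integral_prod _ iF2, integral_prod _ iF]
  nlinarith [sq_nonneg ((∫ x, m x ∂μ) - G)]

/-- The Efron–Stein inequality, with the `i`-th coordinate frozen to `c`, on `Fin n`. -/
lemma variance_pi_fin_le {α : Type*} [MeasurableSpace α] (μ : Measure α) [IsProbabilityMeasure μ]
    (c : α) {C : ℝ} (n : ℕ) {F : (Fin n → α) → ℝ} (hF : Measurable F) (hFC : ∀ w, |F w| ≤ C) :
    ProbabilityTheory.variance F (Measure.pi fun _ => μ) ≤
      ∑ i, ∫ w, (F w - F (Function.update w i c)) ^ 2 ∂(Measure.pi fun _ => μ) := by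
  induction n with
  | zero =>
    have : F = fun _ => F default := funext fun w => by rw [Subsingleton.elim w default]
    rw [this]
    simp [ProbabilityTheory.variance_eq_integral]
  | succ n ih =>
    have hmp := (measurePreserving_piFinSuccAbove (fun _ : Fin (n + 1) => μ) 0).symm
    set e := (MeasurableEquiv.piFinSuccAbove (fun _ : Fin (n + 1) => α) 0).symm with he
    have hecons : ∀ x y, e (x, y) = Fin.cons x y := fun x y => by
      rw [he, ← Fin.insertNth_zero']; rfl
    have hmcons : Measurable fun z : α × (Fin n → α) => F (e z) := hF.comp e.measurable
    have hup : ∀ i, Measurable fun z : α × (Fin n → α) =>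
        (F (e z) - F (Function.update (e z) i c)) ^ 2 := fun i =>
      (hmcons.sub (hF.comp (measurable_update_left.comp e.measurable))).pow_const 2
    have hint : ∀ i, Integrable (fun z : α × (Fin n → α) =>
        (F (e z) - F (Function.update (e z) i c)) ^ 2) (μ.prod (Measure.pi fun _ => μ)) :=
      fun i => by
        refine Integrable.of_bound (hup i).aestronglyMeasurable ((C + C) ^ 2)
          (ae_of_all _ fun z => ?_)
        rw [Real.norm_eq_abs, abs_pow]
        exact pow_le_pow_left₀ (abs_nonneg _)
          ((abs_sub _ _).trans (add_le_add (hFC _) (hFC _))) 2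
    have hmain := variance_prod_le μ (Measure.pi fun _ : Fin n => μ) (F := fun z => F (e z))
      (g := fun y => F (e (c, y))) hmcons (hmcons.comp measurable_prodMk_left)
      (fun z => hFC _) (fun y => hFC _)
    rw [← hmp.variance_fun_comp hF.aemeasurable]
    refine hmain.trans ?_
    rw [Fin.sum_univ_succ]
    refine add_le_add (le_of_eq ?_) ?_
    · rw [← hmp.integral_comp']
      refine integral_congr_ae (ae_of_all _ fun z => ?_)
      obtain ⟨x, y⟩ := z
      change (F (e (x, y)) - F (e (c, y))) ^ 2 =
        (F (e (x, y)) - F (Function.update (e (x, y)) 0 c)) ^ 2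
      simp only [hecons, Fin.update_cons_zero]
    · have hstep : ∀ x, ProbabilityTheory.variance (fun y => F (e (x, y)))
          (Measure.pi fun _ : Fin n => μ) ≤
          ∑ i : Fin n, ∫ y, (F (e (x, y)) - F (Function.update (e (x, y)) i.succ c)) ^ 2
            ∂(Measure.pi fun _ : Fin n => μ) := fun x => by
        refine (ih (hmcons.comp measurable_prodMk_left) fun w => hFC _).trans (le_of_eq ?_)
        simp only [Function.comp_def, hecons, Fin.cons_update]
      refine (integral_mono_of_nonneg
        (ae_of_all _ fun x => ProbabilityTheory.variance_nonneg _ _)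
        (integrable_finsetSum _ fun i _ => (hint i.succ).integral_prod_left)
        (ae_of_all _ hstep)).trans (le_of_eq ?_)
      rw [integral_finsetSum _ fun i _ => (hint i.succ).integral_prod_left]
      refine Finset.sum_congr rfl fun i _ => ?_
      rw [← hmp.integral_comp', integral_prod _ (hint i.succ)]

/-- The Efron–Stein inequality, with the `i`-th coordinate frozen to `c`. -/
lemma variance_pi_le {ι α : Type*} [Fintype ι] [DecidableEq ι] [MeasurableSpace α]
    (μ : Measure α) [IsProbabilityMeasure μ]
    (c : α) {C : ℝ} {F : (ι → α) → ℝ} (hF : Measurable F) (hFC : ∀ w, |F w| ≤ C) :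
    ProbabilityTheory.variance F (Measure.pi fun _ => μ) ≤
      ∑ i, ∫ w, (F w - F (Function.update w i c)) ^ 2 ∂(Measure.pi fun _ => μ) := by
  let f := (Fintype.equivFin ι).symm
  have hmp := measurePreserving_piCongrLeft (fun _ : ι => μ) f
  set e := MeasurableEquiv.piCongrLeft (fun _ : ι => α) f with he
  have hee : ∀ w i, e w (f i) = w i := fun w i => Equiv.piCongrLeft_apply_apply (fun _ : ι => α) f w i
  rw [← hmp.variance_fun_comp hF.aemeasurable]
  refine (variance_pi_fin_le μ c _ (hF.comp e.measurable) fun w => hFC _).trans (le_of_eq ?_)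
  rw [← f.sum_comp]
  refine Finset.sum_congr rfl fun i _ => ?_
  rw [← hmp.integral_comp']
  refine integral_congr_ae (ae_of_all _ fun w => ?_)
  have : e (Function.update w i c) = Function.update (e w) (f i) c := by
    funext v
    obtain ⟨j, rfl⟩ := f.surjective v
    rw [hee]
    by_cases h : j = i
    · subst h; simp
    · rw [Function.update_of_ne h, Function.update_of_ne (f.injective.ne h), hee]
  simp only [Function.comp_def, this]

lemma measurableSet_pairwise_lt {V : Type*} [Fintype V] (l : List V) :
    MeasurableSet {w : V → ℝ | l.Pairwise fun a b => w a < w b} := by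
  simp only [List.pairwise_iff_get, Set.ofPred_forall]
  exact MeasurableSet.iInter fun i => MeasurableSet.iInter fun j => MeasurableSet.iInter fun _ =>
    measurableSet_lt (measurable_pi_apply _) (measurable_pi_apply _)

/-- Under i.i.d. weights, a prescribed list of vertices is strictly increasingly weighted with
probability at most one over the factorial of its length. -/
lemma pi_pairwise_lt_le {V : Type*} [Fintype V] [DecidableEq V] (μ : Measure ℝ)
    [IsProbabilityMeasure μ] (l : List V) :
    (Measure.pi fun _ : V => μ).real {w | l.Pairwise fun a b => w a < w b} ≤
      1 / (l.length.factorial : ℝ) := by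
  by_cases hl : l.Nodup
  swap
  · have : {w : V → ℝ | l.Pairwise fun a b => w a < w b} = ∅ := by
      ext w
      simp only [Set.mem_ofPred_eq, Set.mem_empty_iff_false, iff_false]
      exact fun h => hl (h.imp fun hab => by rintro rfl; exact lt_irrefl _ hab)
    rw [this]
    simp
  set k := l.length
  let z : Fin k ↪ V := ⟨l.get, List.nodup_iff_injective_get.1 hl⟩
  let A : Equiv.Perm (Fin k) → Set (V → ℝ) := fun σ => {w | StrictMono fun i => w (z (σ i))}
  have hA1 : {w : V → ℝ | l.Pairwise fun a b => w a < w b} = A 1 := by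
    ext w
    simp only [List.pairwise_iff_get, Set.mem_ofPred_eq, A]
    exact Iff.rfl
  have hmeas : ∀ σ, MeasurableSet (A σ) := fun σ => by
    simp only [A, StrictMono, Set.ofPred_forall]
    exact MeasurableSet.iInter fun i => MeasurableSet.iInter fun j => MeasurableSet.iInter fun _ =>
      measurableSet_lt (measurable_pi_apply _) (measurable_pi_apply _)
  have hdisj : Pairwise (Function.onFun Disjoint A) := fun σ τ hne => by
    refine Set.disjoint_left.2 fun w hσ hτ => hne ?_
    have hrange : ∀ ρ : Equiv.Perm (Fin k),
        Set.range (fun i => w (z (ρ i))) = Set.range fun i => w (z i) := fun ρ =>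
      ρ.surjective.range_comp fun i => w (z i)
    have heq := (StrictMono.range_inj hσ hτ).1 ((hrange σ).trans (hrange τ).symm)
    have hinj : Function.Injective fun i => w (z i) := by
      have := (StrictMono.injective hσ).comp σ.symm.injective
      simpa [Function.comp_def] using this
    exact Equiv.ext fun i => hinj (congrFun heq i)
  have hsymm : ∀ σ, (Measure.pi fun _ : V => μ).real (A σ) =
      (Measure.pi fun _ : V => μ).real (A 1) := fun σ => by
    let f : Equiv.Perm V := σ.viaFintypeEmbedding z
    have hmp := measurePreserving_piCongrLeft (fun _ : V => μ) f
    set e := MeasurableEquiv.piCongrLeft (fun _ : V => ℝ) f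
    have hee : ∀ w i, e w (f i) = w i :=
      fun w i => Equiv.piCongrLeft_apply_apply (fun _ : V => ℝ) f w i
    have : e ⁻¹' (A σ) = A 1 := by
      ext w
      have : ∀ i, e w (z (σ i)) = w (z i) := fun i => by
        rw [← hee w (z i), Equiv.Perm.viaFintypeEmbedding_apply_image]
      simp only [A, Set.mem_preimage, Set.mem_ofPred_eq, this, Equiv.Perm.one_apply]
    rw [Measure.real, Measure.real, ← this, hmp.measure_preimage_equiv]
  have hsum : ∑ σ, (Measure.pi fun _ : V => μ).real (A σ) ≤ 1 := by
    rw [← measureReal_iUnion_fintype hdisj hmeas]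
    exact measureReal_le_one
  simp only [hsymm, sum_const, card_univ, Fintype.card_perm, Fintype.card_fin, nsmul_eq_mul]
    at hsum
  rw [hA1, le_div_iff₀ (by positivity), mul_comm]
  exact hsum

instance {V : Type*} [Fintype V] : IsProbabilityMeasure (uniformWeights V) := by
  have : IsProbabilityMeasure (volume.restrict (Set.Icc (0 : ℝ) 1)) := ⟨by simp⟩
  unfold uniformWeights
  infer_instance

lemma uniformWeights_eq (V : Type*) [Fintype V] :
    uniformWeights V = volume.restrict (Set.univ.pi fun _ : V => Set.Icc (0 : ℝ) 1) := by
  rw [volume_pi, Measure.restrict_pi_pi]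
  rfl

lemma ae_uniformWeights_nonneg (V : Type*) [Fintype V] :
    ∀ᵐ w ∂uniformWeights V, ∀ v, 0 ≤ w v := by
  rw [uniformWeights_eq]
  filter_upwards [ae_restrict_mem (MeasurableSet.univ_pi fun _ => measurableSet_Icc)] with w hw v
  exact (hw v trivial).1

lemma ae_uniformWeights_injective (V : Type*) [Fintype V] :
    ∀ᵐ w ∂uniformWeights V, Function.Injective w := by
  classical
  have hne : ∀ u v : V, ∀ᵐ w ∂uniformWeights V, w u = w v → u = v := fun u v => by
    by_cases huv : u = v
    · exact ae_of_all _ fun _ _ => huv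
    rw [uniformWeights_eq]
    refine ae_restrict_of_ae ?_
    let L : (V → ℝ) →ₗ[ℝ] ℝ := LinearMap.proj (R := ℝ) (φ := fun _ : V => ℝ) u -
      LinearMap.proj (R := ℝ) (φ := fun _ : V => ℝ) v
    have hL : LinearMap.ker L ≠ ⊤ := fun h => by
      have h1 : L (Pi.single u 1) = 0 := by
        rw [← LinearMap.mem_ker, h]; trivial
      simp [L, Ne.symm huv] at h1
    have h0 := Measure.addHaar_submodule (volume : Measure (V → ℝ)) _ hL
    refine measure_mono_null (fun w hw => ?_) h0
    have : w u = w v := by by_contra hc; exact hw fun h => absurd h hc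
    simp [L, this]
  filter_upwards [ae_all_iff.2 fun u => ae_all_iff.2 fun v => hne u v] with w hw u v h
  exact hw u v h

lemma wellFounded_weight_gt {V : Type*} [Finite V] (w : V → ℝ) : WellFounded fun a b => w b < w a :=
  have : Std.Irrefl fun a b : V => w b < w a := ⟨fun _ => lt_irrefl _⟩
  have : IsTrans V fun a b => w b < w a := ⟨fun _ _ _ h h' => h'.trans h⟩
  Finite.wellFounded_of_trans_of_irrefl _

section Greedy

variable {V : Type*} [DecidableEq V]

/-- The vertices sharing an edge with `v`. -/
def edgeNeighbors (E : Finset (Finset V)) (v : V) : Finset V :=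
  (E.filter fun e => v ∈ e).biUnion fun e => e.erase v

lemma mem_edgeNeighbors {E : Finset (Finset V)} {u v : V} :
    u ∈ edgeNeighbors E v ↔ ∃ e ∈ E, v ∈ e ∧ u ≠ v ∧ u ∈ e := by
  simp [edgeNeighbors, and_assoc]

lemma card_edgeNeighbors_le {E : Finset (Finset V)} {r d : ℕ} (hE : ∀ e ∈ E, e.card = r + 1) {v : V}
    (hdeg : (E.filter fun e => v ∈ e).card ≤ d) : (edgeNeighbors E v).card ≤ d * r := by
  refine (card_biUnion_le_card_mul _ _ r fun e he => ?_).trans (Nat.mul_le_mul_right r hdeg)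
  rw [mem_filter] at he
  rw [card_erase_of_mem he.2, hE e he.1]
  simp

variable [Fintype V]

lemma greedySelect_iff (E : Finset (Finset V)) (w : V → ℝ) (v : V) :
    greedySelect E w v ↔ ¬ ∃ e ∈ E, v ∈ e ∧ (∀ u ∈ e, u ≠ v → w v < w u) ∧
      (∀ u ∈ e, u ≠ v → w v < w u → greedySelect E w u) := by
  rw [greedySelect]

lemma greedySelect_congr (E : Finset (Finset V)) {w w' : V → ℝ}
    (h : ∀ u v, w u < w v ↔ w' u < w' v) (v : V) : greedySelect E w v ↔ greedySelect E w' v := by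
  induction v using (wellFounded_weight_gt w).induction with
  | _ v ih =>
    rw [greedySelect_iff, greedySelect_iff E w']
    simp only [h] at ih ⊢
    refine not_congr (exists_congr fun e => and_congr_right fun _ => and_congr_right fun _ =>
      and_congr_right fun _ => forall_congr' fun u => forall_congr' fun _ => forall_congr' fun _ =>
      forall_congr' fun hlt => ih u hlt)

lemma measurable_greedySet_card (E : Finset (Finset V)) :
    Measurable fun w : V → ℝ => ((greedySet E w).card : ℝ) := by
  classical
  let pat : (V → ℝ) → V × V → Bool := fun w p => decide (w p.1 < w p.2)
  have hpat : Measurable pat := measurable_pi_lambda _ fun p =>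
    measurable_to_bool (by
      simpa [Set.preimage, pat] using
        measurableSet_lt (measurable_pi_apply (X := fun _ : V => ℝ) p.1) (measurable_pi_apply p.2))
  have hfac : Function.FactorsThrough (fun w : V → ℝ => ((greedySet E w).card : ℝ)) pat := by
    intro w w' h
    have : greedySet E w = greedySet E w' := by
      refine Finset.filter_congr fun v _ => greedySelect_congr E (fun a b => ?_) v
      simpa [pat] using congrFun h (a, b)
    simp only [this]
  rw [← hfac.extend_comp (0 : (V × V → Bool) → ℝ)]
  exact (measurable_of_finite _).comp hpat

/-- If lowering the weight of `v` below all others changes the status of `u ≠ v`, then some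
heavier neighbor of `u` is `v` itself or has changed its status too. -/
lemma exists_heavier_neighbor (E : Finset (Finset V)) {w : V → ℝ} {v u : V} {c : ℝ}
    (hc : ∀ x, c < w x) (huv : u ≠ v)
    (hu : ¬ (greedySelect E w u ↔ greedySelect E (Function.update w v c) u)) :
    ∃ p, (p = v ∨ ¬ (greedySelect E w p ↔ greedySelect E (Function.update w v c) p)) ∧
      u ∈ edgeNeighbors E p ∧ w u < w p := by
  by_contra hcon
  have hcon' : ∀ p, u ∈ edgeNeighbors E p → w u < w p →
      p ≠ v ∧ (greedySelect E w p ↔ greedySelect E (Function.update w v c) p) := fun p hp hlt =>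
    ⟨fun h => hcon ⟨p, Or.inl h, hp, hlt⟩,
      Classical.by_contradiction fun h => hcon ⟨p, Or.inr h, hp, hlt⟩⟩
  apply hu
  rw [greedySelect_iff, greedySelect_iff E (Function.update w v c)]
  refine not_congr (exists_congr fun e => and_congr_right fun he => and_congr_right fun hue => ?_)
  have hnb : ∀ p ∈ e, p ≠ u → u ∈ edgeNeighbors E p := fun p hp hpu =>
    mem_edgeNeighbors.2 ⟨e, he, hp, hpu.symm, hue⟩
  have hwu : Function.update w v c u = w u := Function.update_of_ne huv _ _
  by_cases hve : v ∈ e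
  · refine ⟨fun h => ?_, fun h => ?_⟩
    · exact absurd rfl (hcon' v (hnb v hve huv.symm) (h.1 v hve huv.symm)).1
    · have := h.1 v hve huv.symm
      rw [hwu, Function.update_self] at this
      exact absurd this (hc u).not_gt
  · have hw : ∀ p ∈ e, Function.update w v c p = w p := fun p hp =>
      Function.update_of_ne (fun h => hve (by rwa [← h])) _ _
    refine and_congr (forall_congr' fun p => forall_congr' fun hp => forall_congr' fun _ => ?_)
      (forall_congr' fun p => forall_congr' fun hp => forall_congr' fun hpu => ?_)
    · rw [hwu, hw p hp]
    · rw [hwu, hw p hp]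
      exact forall_congr' fun hlt => (hcon' p (hnb p hp hpu) hlt).2

end Greedy

section Codes

variable {V : Type*} [DecidableEq V]

/-- Walks of length `N` from `v` along `nb`, as pairs of an end vertex and the list of visited
vertices, latest first. -/
def walkCodes (nb : V → Finset V) (v : V) : ℕ → Finset (V × List V)
  | 0 => {(v, [v])}
  | N + 1 => (walkCodes nb v N).biUnion fun t => (nb t.1).image fun c => (c, c :: t.2)

/-- Pairs of end vertices of two walks from `v` along `nb` which share an initial segment and are
then extended one step at a time, together with the list of the `N + 1` vertices visited,
latest first. -/
def forkCodes (nb : V → Finset V) (v : V) : ℕ → Finset (V × V × List V)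
  | 0 => {(v, v, [v])}
  | N + 1 =>
    (forkCodes nb v N).biUnion (fun t =>
      (nb t.1).image (fun c => (c, t.2.1, c :: t.2.2)) ∪
        (nb t.2.1).image fun c => (t.1, c, c :: t.2.2)) ∪
    (walkCodes nb v (N + 1)).image fun s => (s.1, s.1, s.2)

variable {nb : V → Finset V} {v : V}

lemma diag_mem_forkCodes {u : V} {l : List V} {N : ℕ} (h : (u, l) ∈ walkCodes nb v N) :
    (u, u, l) ∈ forkCodes nb v N := by
  cases N with
  | zero => simpa [walkCodes, forkCodes] using h
  | succ N => exact mem_union_right _ (mem_image.2 ⟨_, h, rfl⟩)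

lemma cons_mem_walkCodes {u c : V} {l : List V} {N : ℕ} (h : (u, l) ∈ walkCodes nb v N)
    (hc : c ∈ nb u) : (c, c :: l) ∈ walkCodes nb v (N + 1) :=
  mem_biUnion.2 ⟨_, h, mem_image.2 ⟨c, hc, rfl⟩⟩

lemma cons_left_mem_forkCodes {u u' c : V} {l : List V} {N : ℕ}
    (h : (u, u', l) ∈ forkCodes nb v N) (hc : c ∈ nb u) :
    (c, u', c :: l) ∈ forkCodes nb v (N + 1) :=
  mem_union_left _ (mem_biUnion.2 ⟨_, h, mem_union_left _ (mem_image.2 ⟨c, hc, rfl⟩)⟩)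

lemma cons_right_mem_forkCodes {u u' c : V} {l : List V} {N : ℕ}
    (h : (u, u', l) ∈ forkCodes nb v N) (hc : c ∈ nb u') :
    (u, c, c :: l) ∈ forkCodes nb v (N + 1) :=
  mem_union_left _ (mem_biUnion.2 ⟨_, h, mem_union_right _ (mem_image.2 ⟨c, hc, rfl⟩)⟩)

lemma length_of_mem_walkCodes {N : ℕ} {t : V × List V} (h : t ∈ walkCodes nb v N) :
    t.2.length = N + 1 := by
  induction N generalizing t with
  | zero => simp only [walkCodes, mem_singleton] at h; simp [h]
  | succ N ih =>
    simp only [walkCodes, mem_biUnion, mem_image] at h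
    obtain ⟨s, hs, c, -, rfl⟩ := h
    simp [ih hs]

lemma length_of_mem_forkCodes {N : ℕ} {t : V × V × List V} (h : t ∈ forkCodes nb v N) :
    t.2.2.length = N + 1 := by
  induction N generalizing t with
  | zero => simp only [forkCodes, mem_singleton] at h; simp [h]
  | succ N ih =>
    simp only [forkCodes, mem_union, mem_biUnion, mem_image] at h
    rcases h with ⟨s, hs, ⟨c, -, rfl⟩ | ⟨c, -, rfl⟩⟩ | ⟨s, hs, rfl⟩
    · simp [ih hs]
    · simp [ih hs]
    · exact length_of_mem_walkCodes hs

lemma card_walkCodes_le {M : ℕ} (hM : ∀ a, (nb a).card ≤ M) (N : ℕ) :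
    (walkCodes nb v N).card ≤ M ^ N := by
  induction N with
  | zero => simp [walkCodes]
  | succ N ih =>
    rw [pow_succ]
    exact (card_biUnion_le_card_mul _ _ M fun t _ => card_image_le.trans (hM _)).trans
      (Nat.mul_le_mul_right M ih)

lemma card_forkCodes_le {M : ℕ} (hM : ∀ a, (nb a).card ≤ M) (N : ℕ) :
    (forkCodes nb v N).card + M ^ N ≤ 2 ^ (N + 1) * M ^ N := by
  induction N with
  | zero => simp [forkCodes]
  | succ N ih =>
    have h1 : (forkCodes nb v (N + 1)).card ≤
        (forkCodes nb v N).card * (M + M) + M ^ (N + 1) := by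
      refine (card_union_le _ _).trans (add_le_add
        (card_biUnion_le_card_mul _ _ _ fun t _ => ?_)
        (card_image_le.trans (card_walkCodes_le hM _)))
      exact (card_union_le _ _).trans
        (add_le_add (card_image_le.trans (hM _)) (card_image_le.trans (hM _)))
    calc _ ≤ (forkCodes nb v N).card * (M + M) + M ^ (N + 1) + M ^ (N + 1) := by gcongr
      _ = 2 * M * ((forkCodes nb v N).card + M ^ N) := by ring
      _ ≤ 2 * M * (2 ^ (N + 1) * M ^ N) := by gcongr
      _ = _ := by ring

variable {w : V → ℝ} {B : Finset V}

lemma exists_walkCode [Fintype V]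
    (hB : ∀ u ∈ B, u ≠ v → ∃ p ∈ B, u ∈ nb p ∧ w u < w p) (u : V) (hu : u ∈ B) :
    ∃ N l, (u, l) ∈ walkCodes nb v N ∧ l.Pairwise (fun a b => w a < w b) ∧
      (∀ x ∈ l, w u ≤ w x) ∧ v ∈ l := by
  induction u using (wellFounded_weight_gt w).induction with
  | _ u ih =>
    by_cases huv : u = v
    · subst huv
      exact ⟨0, [u], by simp [walkCodes], by simp, by simp, by simp⟩
    · obtain ⟨p, hp, hup, hlt⟩ := hB u hu huv
      obtain ⟨N, l, hl, hpw, hmin, hv⟩ := ih p hlt hp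
      refine ⟨N + 1, u :: l, cons_mem_walkCodes hl hup,
        List.pairwise_cons.2 ⟨fun x hx => hlt.trans_le (hmin x hx), hpw⟩, ?_,
        List.mem_cons_of_mem _ hv⟩
      simp only [List.mem_cons, forall_eq_or_imp, le_refl, true_and]
      exact fun x hx => hlt.le.trans (hmin x hx)

lemma exists_forkCode [Fintype V] (hw : Function.Injective w)
    (hB : ∀ u ∈ B, u ≠ v → ∃ p ∈ B, u ∈ nb p ∧ w u < w p) (t : V × V)
    (hu : t.1 ∈ B) (hu' : t.2 ∈ B) :
    ∃ N l, (t.1, t.2, l) ∈ forkCodes nb v N ∧ l.Pairwise (fun a b => w a < w b) ∧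
      ∀ x ∈ l, min (w t.1) (w t.2) ≤ w x := by
  have hwf : WellFounded fun a b : V × V => w b.1 + w b.2 < w a.1 + w a.2 :=
    have : Std.Irrefl fun a b : V × V => w b.1 + w b.2 < w a.1 + w a.2 := ⟨fun _ => lt_irrefl _⟩
    have : IsTrans (V × V) fun a b => w b.1 + w b.2 < w a.1 + w a.2 := ⟨fun _ _ _ h h' => h'.trans h⟩
    Finite.wellFounded_of_trans_of_irrefl _
  have htop : ∀ x ∈ B, w x ≤ w v := fun x hx => by
    obtain ⟨N, l, -, -, hmin, hv⟩ := exists_walkCode hB x hx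
    exact hmin v hv
  induction t using hwf.induction with
  | _ t ih =>
    obtain ⟨u, u'⟩ := t
    dsimp only at *
    rcases lt_trichotomy (w u) (w u') with hlt | heq | hlt
    · obtain ⟨p, hp, hup, hwp⟩ := hB u hu fun h => (htop u' hu').not_gt (h ▸ hlt)
      obtain ⟨N, l, hl, hpw, hmin⟩ := ih (p, u') (by simpa using hwp) hp hu'
      have hx : ∀ x ∈ l, w u < w x := fun x hx => (lt_min hwp hlt).trans_le (hmin x hx)
      refine ⟨N + 1, u :: l, cons_left_mem_forkCodes hl hup, List.pairwise_cons.2 ⟨hx, hpw⟩, ?_⟩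
      simp only [List.mem_cons, forall_eq_or_imp]
      exact ⟨min_le_left _ _, fun x h => (min_le_left _ _).trans (hx x h).le⟩
    · obtain rfl := hw heq
      obtain ⟨N, l, hl, hpw, hmin, -⟩ := exists_walkCode hB u hu
      exact ⟨N, l, diag_mem_forkCodes hl, hpw, fun x hx => (min_le_left _ _).trans (hmin x hx)⟩
    · obtain ⟨p, hp, hup, hwp⟩ := hB u' hu' fun h => (htop u hu).not_gt (h ▸ hlt)
      obtain ⟨N, l, hl, hpw, hmin⟩ := ih (u, p) (by simpa using hwp) hu hp
      have hx : ∀ x ∈ l, w u' < w x := fun x hx => (lt_min hlt hwp).trans_le (hmin x hx)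
      refine ⟨N + 1, u' :: l, cons_right_mem_forkCodes hl hup, List.pairwise_cons.2 ⟨hx, hpw⟩, ?_⟩
      simp only [List.mem_cons, forall_eq_or_imp]
      exact ⟨min_le_right _ _, fun x h => (min_le_right _ _).trans (hx x h).le⟩

open scoped Classical in
/-- The square of the number of vertices reachable by descending walks is at most the number of
descending fork codes. -/
lemma card_sq_le_sum_forkCodes [Fintype V] (hw : Function.Injective w)
    (hB : ∀ u ∈ B, u ≠ v → ∃ p ∈ B, u ∈ nb p ∧ w u < w p) :
    (B.card : ℝ) ^ 2 ≤ ∑ N ∈ range (Fintype.card V), ∑ t ∈ forkCodes nb v N,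
      {w : V → ℝ | t.2.2.Pairwise fun a b => w a < w b}.indicator 1 w := by
  have hsub : B ×ˢ B ⊆ (range (Fintype.card V)).biUnion fun N =>
      ((forkCodes nb v N).filter fun t => t.2.2.Pairwise fun a b => w a < w b).image
        fun t => (t.1, t.2.1) := by
    intro t ht
    rw [mem_product] at ht
    obtain ⟨N, l, hl, hpw, -⟩ := exists_forkCode hw hB t ht.1 ht.2
    have hnd : l.Nodup := hpw.imp fun h => by rintro rfl; exact lt_irrefl _ h
    have hlen : N < Fintype.card V := by
      have h := hnd.length_le_card
      rw [length_of_mem_forkCodes hl] at h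
      exact h
    exact mem_biUnion.2 ⟨N, mem_range.2 hlen, mem_image.2 ⟨_, mem_filter.2 ⟨hl, hpw⟩, rfl⟩⟩
  have hcard := (card_le_card hsub).trans
    (card_biUnion_le.trans (sum_le_sum fun N _ => card_image_le))
  rw [card_product, ← sq] at hcard
  have : ∀ N, ∑ t ∈ forkCodes nb v N,
      {w : V → ℝ | t.2.2.Pairwise fun a b => w a < w b}.indicator (1 : (V → ℝ) → ℝ) w =
      (((forkCodes nb v N).filter fun t => t.2.2.Pairwise fun a b => w a < w b).card : ℝ) :=
    fun N => by simp [Set.indicator_apply, sum_boole]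
  simp only [this]
  exact_mod_cast hcard

end Codes

lemma abs_card_sub_card_le {V : Type*} [DecidableEq V] {S T B : Finset V}
    (h : ∀ u, ¬ (u ∈ S ↔ u ∈ T) → u ∈ B) : |(S.card : ℝ) - T.card| ≤ B.card := by
  have aux : ∀ {S T : Finset V}, (∀ u, ¬ (u ∈ S ↔ u ∈ T) → u ∈ B) →
      (S.card : ℝ) - T.card ≤ B.card := fun {S T} h => by
    have hST : S ⊆ T ∪ B := fun u hu => by
      by_cases hT : u ∈ T
      · exact mem_union_left _ hT
      · exact mem_union_right _ (h u fun hiff => hT (hiff.1 hu))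
    have : (S.card : ℝ) ≤ T.card + B.card := by
      exact_mod_cast (card_le_card hST).trans (card_union_le _ _)
    linarith
  rw [abs_le]
  have := aux h
  have := aux (S := T) (T := S) fun u hu => h u fun hiff => hu hiff.symm
  constructor <;> linarith

open scoped Classical in
/-- The squared effect on the size of the greedy set of discarding the weight of `v`. -/
lemma sq_greedySet_card_sub_le {V : Type*} [Fintype V] [DecidableEq V] (E : Finset (Finset V))
    {w : V → ℝ} (v : V) {c : ℝ} (hc : ∀ x, c < w x) (hw : Function.Injective w) :
    (((greedySet E w).card : ℝ) - (greedySet E (Function.update w v c)).card) ^ 2 ≤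
      ∑ N ∈ range (Fintype.card V), ∑ t ∈ forkCodes (edgeNeighbors E) v N,
      {w : V → ℝ | t.2.2.Pairwise fun a b => w a < w b}.indicator 1 w := by
  set B : Finset V := univ.filter fun u =>
    u = v ∨ ¬ (greedySelect E w u ↔ greedySelect E (Function.update w v c) u) with hBdef
  have hmem : ∀ u, u ∈ B ↔
      (u = v ∨ ¬ (greedySelect E w u ↔ greedySelect E (Function.update w v c) u)) := fun u => by
    simp [hBdef]
  refine le_trans ?_ (card_sq_le_sum_forkCodes (B := B) hw fun u hu huv => ?_)
  · refine sq_le_sq.2 (le_trans (abs_card_sub_card_le fun u hu => ?_) (le_abs_self _))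
    rw [hmem]
    right
    simpa [greedySet] using hu
  · obtain ⟨p, hp, h⟩ := exists_heavier_neighbor E hc huv (((hmem u).1 hu).resolve_left huv)
    exact ⟨p, (hmem p).2 hp, h⟩

lemma sum_two_pow_mul_pow_div_factorial_le {M : ℝ} (hM : 0 < M) (n : ℕ) :
    ∑ N ∈ range n, 2 ^ (N + 1) * M ^ N / ((N + 1).factorial : ℝ) ≤ Real.exp (2 * M) / M := by
  rw [le_div_iff₀ hM, sum_mul]
  have h := Real.sum_le_exp_of_nonneg (x := 2 * M) (by positivity) (n + 1)
  rw [sum_range_succ'] at h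
  have heq : ∀ N ∈ range n, 2 ^ (N + 1) * M ^ N / ((N + 1).factorial : ℝ) * M =
      (2 * M) ^ (N + 1) / ((N + 1).factorial : ℝ) := fun N _ => by
    rw [mul_pow, pow_succ M]; ring
  rw [sum_congr rfl heq]
  simp only [pow_zero, Nat.factorial_zero, Nat.cast_one, div_one] at h
  linarith

lemma exp_two_mul_div_le {r d : ℕ} (hr : 1 ≤ r) (hd : 2 ≤ d) :
    Real.exp (2 * ((d : ℝ) * r)) / ((d : ℝ) * r) ≤
      3 * d ^ 2 * r ^ 2 * Real.exp ((r : ℝ) ^ 2 * ((d : ℝ) - 1) ^ 3) := by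
  have hr' : (1 : ℝ) ≤ r := by exact_mod_cast hr
  have hd' : (2 : ℝ) ≤ d := by exact_mod_cast hd
  have hM : (2 : ℝ) ≤ d * r := by nlinarith
  have key : ∀ s : ℝ, 2 * ((d : ℝ) * r) ≤ s + (r : ℝ) ^ 2 * ((d : ℝ) - 1) ^ 3 →
      Real.exp s ≤ 3 * ((d : ℝ) * r) ^ 3 →
      Real.exp (2 * ((d : ℝ) * r)) / ((d : ℝ) * r) ≤
      3 * d ^ 2 * r ^ 2 * Real.exp ((r : ℝ) ^ 2 * ((d : ℝ) - 1) ^ 3) := fun s h1 h2 => by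
    rw [div_le_iff₀ (by linarith)]
    calc _ ≤ Real.exp (s + (r : ℝ) ^ 2 * ((d : ℝ) - 1) ^ 3) := Real.exp_le_exp.2 h1
      _ = Real.exp s * Real.exp ((r : ℝ) ^ 2 * ((d : ℝ) - 1) ^ 3) := Real.exp_add _ _
      _ ≤ 3 * ((d : ℝ) * r) ^ 3 * Real.exp ((r : ℝ) ^ 2 * ((d : ℝ) - 1) ^ 3) := by gcongr
      _ = _ := by ring
  have hexp : ∀ k : ℕ, Real.exp k ≤ 2.7182818286 ^ k := fun k => by
    rw [← mul_one (k : ℝ), Real.exp_nat_mul]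
    exact pow_le_pow_left₀ (Real.exp_pos _).le Real.exp_one_lt_d9.le k
  have hM3 : ∀ a : ℝ, 0 ≤ a → a ≤ (d : ℝ) * r → 3 * a ^ 3 ≤ 3 * ((d : ℝ) * r) ^ 3 :=
    fun a h0 h => by gcongr
  rcases hd.eq_or_lt with rfl | hd3
  · rcases hr.eq_or_lt with rfl | hr2
    · refine key (3 : ℕ) (by norm_num) ((hexp 3).trans (by norm_num))
    · have hr2' : (2 : ℝ) ≤ r := by exact_mod_cast hr2
      refine key (4 : ℕ) ?_ ((hexp 4).trans (le_trans (by norm_num)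
        (hM3 4 (by norm_num) (by push_cast; linarith))))
      push_cast
      nlinarith [sq_nonneg ((r : ℝ) - 2)]
  · have hd3' : (3 : ℝ) ≤ d := by exact_mod_cast hd3
    refine key 0 ?_ (by rw [Real.exp_zero]; linarith [hM3 2 (by norm_num) hM])
    have h1 : 2 * (d : ℝ) ≤ ((d : ℝ) - 1) ^ 3 := by
      nlinarith [mul_nonneg (sub_nonneg.2 hd3') (sub_nonneg.2 hd3'),
        mul_nonneg (mul_nonneg (sub_nonneg.2 hd3') (sub_nonneg.2 hd3')) (sub_nonneg.2 hd3')]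
    have h2 : (r : ℝ) ≤ (r : ℝ) ^ 2 := by nlinarith
    calc 2 * ((d : ℝ) * r) = r * (2 * d) := by ring
      _ ≤ (r : ℝ) ^ 2 * ((d : ℝ) - 1) ^ 3 := by gcongr
      _ = _ := by ring

/-- The mean squared effect on the size of the greedy set of discarding the weight of `v`. -/
lemma integral_sq_greedySet_card_sub_le {V : Type*} [Fintype V] [DecidableEq V]
    (E : Finset (Finset V)) (v : V) {M : ℕ} (hM0 : 0 < M)
    (hM : ∀ a, (edgeNeighbors E a).card ≤ M) :
    ∫ w, (((greedySet E w).card : ℝ) - (greedySet E (Function.update w v (-1))).card) ^ 2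
      ∂uniformWeights V ≤ Real.exp (2 * M) / M := by
  classical
  have : IsProbabilityMeasure (volume.restrict (Set.Icc (0 : ℝ) 1)) := ⟨by simp⟩
  have hint : ∀ t : V × V × List V, Integrable
      ({w : V → ℝ | t.2.2.Pairwise fun a b => w a < w b}.indicator (1 : (V → ℝ) → ℝ))
      (uniformWeights V) := fun t =>
    (integrable_const (1 : ℝ)).indicator (measurableSet_pairwise_lt _)
  calc _ ≤ ∫ w, ∑ N ∈ range (Fintype.card V), ∑ t ∈ forkCodes (edgeNeighbors E) v N,
        {w : V → ℝ | t.2.2.Pairwise fun a b => w a < w b}.indicator (1 : (V → ℝ) → ℝ) w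
        ∂uniformWeights V := by
        refine integral_mono_of_nonneg (ae_of_all _ fun w => sq_nonneg _)
          (integrable_finsetSum _ fun N _ => integrable_finsetSum _ fun t _ => hint t) ?_
        filter_upwards [ae_uniformWeights_nonneg V, ae_uniformWeights_injective V] with w h0 hinj
        exact sq_greedySet_card_sub_le E v (fun x => by linarith [h0 x]) hinj
    _ = ∑ N ∈ range (Fintype.card V), ∑ t ∈ forkCodes (edgeNeighbors E) v N,
        (uniformWeights V).real {w | t.2.2.Pairwise fun a b => w a < w b} := by
        rw [integral_finsetSum _ fun N _ => integrable_finsetSum _ fun t _ => hint t]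
        refine sum_congr rfl fun N _ => ?_
        rw [integral_finsetSum _ fun t _ => hint t]
        exact sum_congr rfl fun t _ => integral_indicator_one (measurableSet_pairwise_lt _)
    _ ≤ ∑ N ∈ range (Fintype.card V), 2 ^ (N + 1) * (M : ℝ) ^ N / ((N + 1).factorial : ℝ) := by
        refine sum_le_sum fun N _ => ?_
        have hcard : ((forkCodes (edgeNeighbors E) v N).card : ℝ) ≤ 2 ^ (N + 1) * (M : ℝ) ^ N := by
          exact_mod_cast (Nat.le_add_right _ _).trans (card_forkCodes_le hM N)
        refine (sum_le_card_nsmul _ _ (1 / ((N + 1).factorial : ℝ)) fun t ht => ?_).trans ?_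
        · rw [← length_of_mem_forkCodes ht]
          exact pi_pairwise_lt_le _ _
        · rw [nsmul_eq_mul, mul_one_div]
          gcongr
    _ ≤ _ := sum_two_pow_mul_pow_div_factorial_le (by exact_mod_cast hM0) _

theorem greedy_variance_bound
    (r d n : ℕ) (hr : 1 ≤ r) (hd : 2 ≤ d)
    (V : Type) [Fintype V] [DecidableEq V] (hn : Fintype.card V = n)
    (E : Finset (Finset V))
    (huniform : ∀ e ∈ E, e.card = r + 1)
    (hlinear : ∀ e ∈ E, ∀ f ∈ E, e ≠ f → (e ∩ f).card ≤ 1)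
    (hdeg : ∀ v : V, (E.filter (fun e => v ∈ e)).card ≤ d) :
    ProbabilityTheory.variance (fun w : V → ℝ => ((greedySet E w).card : ℝ))
        (uniformWeights V) ≤
      3 * d ^ 2 * r ^ 2 * Real.exp ((r : ℝ) ^ 2 * ((d : ℝ) - 1) ^ 3) * n := by
  have : IsProbabilityMeasure (volume.restrict (Set.Icc (0 : ℝ) 1)) := ⟨by simp⟩
  have hM : ∀ a, (edgeNeighbors E a).card ≤ d * r := fun a =>
    card_edgeNeighbors_le huniform (hdeg a)
  refine (variance_pi_le (volume.restrict (Set.Icc (0 : ℝ) 1)) (-1) (C := Fintype.card V)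
    (measurable_greedySet_card E) fun w => ?_).trans ?_
  · rw [Nat.abs_cast]
    exact_mod_cast card_le_univ _
  · refine (sum_le_card_nsmul _ _
      (3 * d ^ 2 * r ^ 2 * Real.exp ((r : ℝ) ^ 2 * ((d : ℝ) - 1) ^ 3)) fun v _ =>
      (integral_sq_greedySet_card_sub_le E v (by positivity) hM).trans ?_).trans_eq ?_
    · push_cast
      exact exp_two_mul_div_le hr hd
    · rw [card_univ, hn, nsmul_eq_mul, mul_comm]
end
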